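/- Fix an integer d ≥ 2 and let 𝕏_d(H) denote either 𝔸_d(H) or 𝔸'_d(H); for a set J ⊂ [0,1] write #(J ∩ 𝕏_d(H)) for the number of α ∈ 𝕏_d(H) whose reduction modulo 1 lies in J. Define the upper density d̄(Ψ) = limsup_{Q₁→∞} limsup_{Q₂→∞} limsup_{H→∞} #(J_Ψ(Q₁,Q₂) ∩ 𝕏_d(H))/#𝕏_d(H), and the lower density d̲(Ψ) by the same expression with all upper limits replaced by lower limits. Then for any approximation function Ψ: if Σ_{q=1}^∞ Ψ(q) < ∞, one has d̄(Ψ) = d̲(Ψ) = 0; if Σ_{q=1}^∞ Ψ(q) = ∞, one has d̄(Ψ) = d̲(Ψ) = 1. In particular, in both cases the density d(Ψ) := d̄(Ψ) = d̲(Ψ) is well-defined. -/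

import Mathlib

open MeasureTheory Set

noncomputable section

def algSet (d : ℕ) (H : ℝ) : Set ℝ :=
  {α : ℝ | ∃ P : Polynomial ℤ, Irreducible P ∧ P.natDegree = d ∧
    (∀ k, |(P.coeff k : ℝ)| ≤ H) ∧ Polynomial.aeval α P = 0}

def XSet (d : ℕ) (H : ℝ) (prime : Bool) : Set ℝ :=
  if prime then algSet d H ∩ Set.Icc 0 1 else algSet d H

def IsApproxFun (Ψ : ℝ → ℝ) : Prop :=
  (∀ x : ℝ, 0 < x → 0 < Ψ x) ∧ AntitoneOn Ψ (Set.Ioi 0) ∧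
    Filter.Tendsto Ψ Filter.atTop (nhds 0)

def JPsi (Ψ : ℝ → ℝ) (Q₁ Q₂ : ℕ) : Set ℝ :=
  ⋃ q ∈ Finset.Ico Q₁ Q₂, ⋃ p ∈ Finset.range (q + 1),
    Set.Icc ((p : ℝ) / q - Ψ q / q) ((p : ℝ) / q + Ψ q / q) ∩ Set.Icc 0 1

def countModOne (Xs : Set ℝ) (J : Set ℝ) : ℕ :=
  Set.ncard {α : ℝ | α ∈ Xs ∧ Int.fract α ∈ J}

/-- The proportion `#(J_Ψ(Q₁,Q₂) ∩ 𝕏_d(H)) / #𝕏_d(H)`. -/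
def ratioRoth (d : ℕ) (prime : Bool) (Ψ : ℝ → ℝ) (Q₁ Q₂ H : ℕ) : ℝ :=
  (countModOne (XSet d H prime) (JPsi Ψ Q₁ Q₂) : ℝ) / (Set.ncard (XSet d H prime) : ℝ)

/-- The upper density `d̄(Ψ)`. -/
def upperDensity (d : ℕ) (prime : Bool) (Ψ : ℝ → ℝ) : ℝ :=
  Filter.limsup (fun Q₁ : ℕ =>
    Filter.limsup (fun Q₂ : ℕ =>
      Filter.limsup (fun H : ℕ => ratioRoth d prime Ψ Q₁ Q₂ H) Filter.atTop)
      Filter.atTop) Filter.atTop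

/-- The lower density `d̲(Ψ)`. -/
def lowerDensity (d : ℕ) (prime : Bool) (Ψ : ℝ → ℝ) : ℝ :=
  Filter.liminf (fun Q₁ : ℕ =>
    Filter.liminf (fun Q₂ : ℕ =>
      Filter.liminf (fun H : ℕ => ratioRoth d prime Ψ Q₁ Q₂ H) Filter.atTop)
      Filter.atTop) Filter.atTop


lemma sum_inv_sq_le (N : ℕ) (hN : 1 ≤ N) :
    ∑ m ∈ Finset.Icc 2 N, (1 : ℝ) / (m : ℝ) ^ 2 ≤ 3 / 4 := by
  have key : ∀ n : ℕ, ∑ m ∈ Finset.Icc 2 (n + 2), (1 : ℝ) / (m : ℝ) ^ 2 ≤ 3 / 4 - 1 / ((n : ℝ) + 2) := by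
    intro n
    induction n with
    | zero => norm_num
    | succ n ih =>
      rw [Finset.sum_Icc_succ_top (by omega)]
      have h : (1 : ℝ) / ((n + 1 + 2 : ℕ) : ℝ) ^ 2 ≤ 1 / ((n : ℝ) + 2) - 1 / ((n : ℝ) + 3) := by
        have : (0 : ℝ) ≤ n := Nat.cast_nonneg n
        push_cast
        rw [div_sub_div _ _ (by positivity) (by positivity), div_le_div_iff₀ (by positivity) (by positivity)]
        nlinarith
      have e : (((n + 1 : ℕ) : ℝ) + 2) = (n : ℝ) + 3 := by push_cast; ring
      rw [e]
      linarith
  rcases Nat.lt_or_ge N 2 with h | h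
  · have : N = 1 := by omega
    subst this; norm_num
  · obtain ⟨n, rfl⟩ := Nat.exists_eq_add_of_le h
    have := key n
    rw [add_comm] at this
    have h2 : (0 : ℝ) ≤ 1 / ((n : ℝ) + 2) := by positivity
    linarith

lemma totient_div_ge (q : ℕ) (hq : 1 ≤ q) :
    (1 : ℝ) - ∑ m ∈ q.divisors.erase 1, (1 : ℝ) / m ≤ (Nat.totient q : ℝ) / q := by
  have h1 : ∑ d ∈ q.divisors, Nat.totient d = q := Nat.sum_totient q
  have h2 : ∑ d ∈ q.divisors, (Nat.totient (q / d)) = q := by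
    rw [Nat.sum_div_divisors q (fun d => Nat.totient d), h1]
  rw [← Finset.add_sum_erase _ _ (Nat.one_mem_divisors.2 (by omega)), Nat.div_one] at h2
  have hq' : (0 : ℝ) < q := by exact_mod_cast hq
  rw [le_div_iff₀ hq', sub_mul, one_mul, Finset.sum_mul]
  have h3 : (∑ x ∈ q.divisors.erase 1, Nat.totient (q / x) : ℝ) ≤
      ∑ i ∈ q.divisors.erase 1, (1 : ℝ) / i * q := by
    apply Finset.sum_le_sum
    intro i hi
    have : (Nat.totient (q / i) : ℝ) ≤ ((q / i : ℕ) : ℝ) := by exact_mod_cast Nat.totient_le _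
    refine this.trans (Nat.cast_div_le.trans (le_of_eq ?_))
    ring
  have h4 : (Nat.totient q : ℝ) + (∑ x ∈ q.divisors.erase 1, Nat.totient (q / x) : ℝ) = q := by
    exact_mod_cast h2
  linarith

lemma sum_totient_div_ge (N : ℕ) :
    (N : ℝ) / 4 ≤ ∑ q ∈ Finset.Icc 1 N, (Nat.totient q : ℝ) / q := by
  rcases Nat.eq_zero_or_pos N with rfl | hN
  · simp
  have h1 : ∑ q ∈ Finset.Icc 1 N, ((1 : ℝ) - ∑ m ∈ q.divisors.erase 1, (1 : ℝ) / m) ≤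
      ∑ q ∈ Finset.Icc 1 N, (Nat.totient q : ℝ) / q :=
    Finset.sum_le_sum fun q hq => totient_div_ge q (Finset.mem_Icc.1 hq).1
  have h2 : ∑ q ∈ Finset.Icc 1 N, ∑ m ∈ q.divisors.erase 1, (1 : ℝ) / m ≤
      ∑ m ∈ Finset.Icc 2 N, (N : ℝ) * (1 / (m : ℝ) ^ 2) := by
    have : ∀ q ∈ Finset.Icc 1 N, ∑ m ∈ q.divisors.erase 1, (1 : ℝ) / m =
        ∑ m ∈ Finset.Icc 2 N, if m ∣ q then (1 : ℝ) / m else 0 := by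
      intro q hq
      rw [Finset.mem_Icc] at hq
      rw [← Finset.sum_filter]
      congr 1
      ext m
      simp only [Finset.mem_erase, Nat.mem_divisors, Finset.mem_filter, Finset.mem_Icc]
      constructor
      · rintro ⟨a, b, c⟩
        have := Nat.le_of_dvd (by omega) b
        have : m ≠ 0 := by rintro rfl; simp at b; omega
        exact ⟨⟨by omega, by omega⟩, b⟩
      · rintro ⟨⟨a, b⟩, c⟩
        exact ⟨by omega, c, by omega⟩
    rw [Finset.sum_congr rfl this, Finset.sum_comm]
    apply Finset.sum_le_sum
    intro m hm
    rw [Finset.mem_Icc] at hm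
    rw [← Finset.sum_filter, Finset.sum_const, nsmul_eq_mul]
    have hc : (Finset.filter (fun q => m ∣ q) (Finset.Icc 1 N)).card = N / m := by
      have := Nat.Ioc_filter_dvd_card_eq_div N m
      rw [← this]; rfl
    rw [hc]
    have hm0 : (0 : ℝ) < m := by exact_mod_cast (by omega : 0 < m)
    have : ((N / m : ℕ) : ℝ) ≤ (N : ℝ) / m := Nat.cast_div_le
    calc ((N / m : ℕ) : ℝ) * (1 / m) ≤ (N : ℝ) / m * (1 / m) := by gcongr
      _ = _ := by field_simp
  rw [← Finset.mul_sum] at h2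
  have h3 := sum_inv_sq_le N hN
  rw [Finset.sum_sub_distrib] at h1
  simp at h1
  have hN' : (0 : ℝ) < N := by exact_mod_cast hN
  simp only [one_div] at *
  nlinarith

lemma abel_ge (f b : ℕ → ℝ) (hf : ∀ n, 1 ≤ n → f (n + 1) ≤ f n) (hf0 : ∀ n, 1 ≤ n → 0 ≤ f n)
    (hb : ∀ N, 0 ≤ ∑ q ∈ Finset.Icc 1 N, b q) (N : ℕ) :
    0 ≤ ∑ q ∈ Finset.Icc 1 N, f q * b q := by
  have key : ∀ n : ℕ, f (n + 1) * ∑ q ∈ Finset.Icc 1 (n + 1), b q ≤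
      ∑ q ∈ Finset.Icc 1 (n + 1), f q * b q := by
    intro n
    induction n with
    | zero => simp
    | succ n ih =>
      rw [Finset.sum_Icc_succ_top (by omega), Finset.sum_Icc_succ_top (by omega) (fun q => f q * b q)]
      have := mul_le_mul_of_nonneg_right (hf (n + 1) (by omega)) (hb (n + 1))
      nlinarith
  rcases N with _ | n
  · simp
  · exact (mul_nonneg (hf0 _ (by omega)) (hb _)).trans (key n)

lemma sum_psi_totient (f : ℕ → ℝ) (hf : ∀ n, 1 ≤ n → f (n + 1) ≤ f n) (hf0 : ∀ n, 1 ≤ n → 0 ≤ f n)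
    (N : ℕ) : (∑ q ∈ Finset.Icc 1 N, f q) / 4 ≤
      ∑ q ∈ Finset.Icc 1 N, f q * ((Nat.totient q : ℝ) / q) := by
  have := abel_ge f (fun q => (Nat.totient q : ℝ) / q - 1 / 4) hf hf0 (by
    intro N
    rw [Finset.sum_sub_distrib]
    have := sum_totient_div_ge N
    simp
    linarith) N
  simp only [mul_sub, Finset.sum_sub_distrib, ← Finset.sum_mul] at this
  linarith

lemma chung_erdos {Ω : Type*} [MeasurableSpace Ω] (μ : Measure Ω) [IsFiniteMeasure μ]
    (s : Finset ℕ) (E : ℕ → Set Ω) (hE : ∀ i, MeasurableSet (E i)) :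
    (∑ i ∈ s, μ.real (E i)) ^ 2 ≤
      μ.real (⋃ i ∈ s, E i) * ∑ i ∈ s, ∑ j ∈ s, μ.real (E i ∩ E j) := by
  set U := ⋃ i ∈ s, E i with hU
  have hUm : MeasurableSet U := Finset.measurableSet_biUnion _ fun i _ => hE i
  have hi : ∀ A : Set Ω, MeasurableSet A → Integrable (A.indicator (fun _ => (1 : ℝ))) μ :=
    fun A hA => (integrable_const 1).indicator hA
  have key : ∀ t : ℝ, 0 ≤ (∑ i ∈ s, ∑ j ∈ s, μ.real (E i ∩ E j)) * (t * t) +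
      (-2 * ∑ i ∈ s, μ.real (E i)) * t + μ.real U := by
    intro t
    have h0 : 0 ≤ ∫ x, (U.indicator (fun _ => (1 : ℝ)) x -
      t * ∑ i ∈ s, (E i).indicator (fun _ => (1 : ℝ)) x) ^ 2 ∂μ :=
      integral_nonneg fun x => sq_nonneg _
    have h1 : ∀ x, (U.indicator (fun _ => (1 : ℝ)) x -
      t * ∑ i ∈ s, (E i).indicator (fun _ => (1 : ℝ)) x) ^ 2 =
      ((t * t) * ∑ i ∈ s, ∑ j ∈ s, (E i ∩ E j).indicator (fun _ => (1 : ℝ)) x) +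
      ((-2 * t) * ∑ i ∈ s, (E i).indicator (fun _ => (1 : ℝ)) x) +
        U.indicator (fun _ => (1 : ℝ)) x := by
      intro x
      have e1 : ∑ i ∈ s, ∑ j ∈ s, (E i ∩ E j).indicator (fun _ => (1 : ℝ)) x =
          (∑ i ∈ s, (E i).indicator (fun _ => (1 : ℝ)) x) ^ 2 := by
        rw [sq, Finset.sum_mul_sum]
        refine Finset.sum_congr rfl fun i _ => Finset.sum_congr rfl fun j _ => ?_
        by_cases h1 : x ∈ E i <;> by_cases h2 : x ∈ E j <;> simp [h1, h2]
      rw [e1]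
      by_cases hx : x ∈ U
      · simp only [Set.indicator_of_mem hx]; ring
      · have : ∑ i ∈ s, (E i).indicator (fun _ => (1 : ℝ)) x = 0 := by
          apply Finset.sum_eq_zero
          intro i hi
          apply Set.indicator_of_notMem
          intro h
          exact hx (Set.mem_biUnion hi h)
        simp [Set.indicator_of_notMem hx, this]
    have i1 : Integrable (fun x => ∑ i ∈ s, (E i).indicator (fun _ => (1 : ℝ)) x) μ :=
      integrable_finsetSum _ fun i _ => hi _ (hE i)
    have i2 : Integrable (fun x => ∑ i ∈ s, ∑ j ∈ s, (E i ∩ E j).indicator (fun _ => (1 : ℝ)) x) μ :=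
      integrable_finsetSum _ fun i _ => integrable_finsetSum _ fun j _ => hi _ ((hE i).inter (hE j))
    have e : ∀ A : Set Ω, MeasurableSet A → ∫ x, A.indicator (fun _ => (1 : ℝ)) x ∂μ = μ.real A := by
      intro A hA
      rw [integral_indicator hA]; simp
    simp_rw [h1] at h0
    have i3 : Integrable (fun x =>
      ((t * t) * ∑ i ∈ s, ∑ j ∈ s, (E i ∩ E j).indicator (fun _ => (1 : ℝ)) x) +
      ((-2 * t) * ∑ i ∈ s, (E i).indicator (fun _ => (1 : ℝ)) x)) μ :=
      (i2.const_mul _).add (i1.const_mul _)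
    rw [integral_add i3 (hi U hUm),
      integral_add (i2.const_mul _) (i1.const_mul _), integral_const_mul, integral_const_mul,
      integral_finsetSum _ (fun i _ => hi _ (hE i)),
      integral_finsetSum _ (fun i _ => integrable_finsetSum _ fun j _ => hi _ ((hE i).inter (hE j))), e U hUm] at h0
    have e2 : ∀ i ∈ s, ∫ x, ∑ j ∈ s, (E i ∩ E j).indicator (fun _ => (1 : ℝ)) x ∂μ =
        ∑ j ∈ s, μ.real (E i ∩ E j) := by
      intro i _
      rw [integral_finsetSum _ (fun j _ => hi _ ((hE i).inter (hE j)))]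
      exact Finset.sum_congr rfl fun j _ => e _ ((hE i).inter (hE j))
    rw [Finset.sum_congr rfl e2, Finset.sum_congr rfl (fun i _ => e _ (hE i))] at h0
    linarith
  have := discrim_le_zero key
  rw [discrim] at this
  nlinarith

def redSet (n : ℕ) : Finset ℕ := (Finset.range n).filter (fun p => Nat.gcd p n = 1)

lemma card_redSet (n : ℕ) : (redSet n).card = Nat.totient n := by
  rw [Nat.totient_eq_card_coprime, redSet]
  congr 1
  ext p
  simp [Nat.Coprime, Nat.gcd_comm]

lemma norm_frac_sub (x y : ℝ) : ‖((x : ℝ) : UnitAddCircle) - ((y : ℝ) : UnitAddCircle)‖ =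
    |x - y - (round (x - y) : ℤ)| := by
  rw [← UnitAddCircle.norm_eq]; rfl

lemma pair_count (q r : ℕ) (hq : 0 < q) (hr : 0 < r) (hqr : q ≠ r) (Δ : ℝ) (hΔ : 0 ≤ Δ) :
    ((((redSet q) ×ˢ (redSet r)).filter (fun z =>
      ‖(((z.1 : ℝ) / q : ℝ) : UnitAddCircle) - (((z.2 : ℝ) / r : ℝ) : UnitAddCircle)‖ < Δ)).card : ℝ)
      ≤ 2 * q * r * Δ := by
  obtain ⟨g, q', r', hg, hcop, rfl, rfl⟩ := Nat.exists_coprime' (m := q) (n := r) (Nat.gcd_pos_of_pos_left _ hq)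
  have hq' : 0 < q' := Nat.pos_of_mul_pos_right hq
  have hr' : 0 < r' := Nat.pos_of_mul_pos_right hr
  have hgR : (0 : ℝ) < g := by exact_mod_cast hg
  have hqR : (0 : ℝ) < q' := by exact_mod_cast hq'
  have hrR : (0 : ℝ) < r' := by exact_mod_cast hr'
  set X : ℝ := g * q' * r' * Δ with hX
  have hX0 : 0 ≤ X := by positivity
  set M : ℕ := ⌊X⌋₊ with hM
  let t : ℕ × ℕ → ℤ := fun z =>
    round ((z.1 : ℝ) / ((q' * g : ℕ) : ℝ) - (z.2 : ℝ) / ((r' * g : ℕ) : ℝ))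
  let k : ℕ × ℕ → ℤ := fun z => z.1 * r' - z.2 * q' - t z * (g * q' * r')
  have hcard := Finset.card_le_card_of_injOn
    (s := ((redSet (q' * g)) ×ˢ (redSet (r' * g))).filter (fun z =>
      ‖(((z.1 : ℝ) / (q' * g : ℕ) : ℝ) : UnitAddCircle) - (((z.2 : ℝ) / (r' * g : ℕ) : ℝ) : UnitAddCircle)‖ < Δ))
    (t := ((Finset.Icc (-(M : ℤ)) M).erase 0) ×ˢ Finset.range g)
    (fun z => (k z, z.1 / q')) ?_ ?_
  · rw [Finset.card_product, Finset.card_erase_of_mem (by simp), Int.card_Icc, Finset.card_range] at hcard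
    have h1 : ((M : ℤ) + 1 - (-M)).toNat - 1 = 2 * M := by omega
    rw [h1] at hcard
    have h2 : (M : ℝ) ≤ X := Nat.floor_le hX0
    calc _ ≤ ((2 * M * g : ℕ) : ℝ) := by exact_mod_cast hcard
      _ = 2 * M * g := by push_cast; ring
      _ ≤ 2 * X * g := by gcongr
      _ = _ := by rw [hX]; push_cast; ring
  · rintro ⟨p, s⟩ hz
    simp only [Finset.coe_filter, Finset.mem_product, redSet, Finset.mem_filter, Finset.mem_range,
      mem_ofPred_eq] at hz
    obtain ⟨⟨⟨hp1, hp2⟩, hs1, hs2⟩, hn⟩ := hz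
    simp only [Finset.coe_product, Finset.coe_erase, Set.mem_prod, Finset.coe_range, Set.mem_Iio,
      Finset.coe_Icc, Set.mem_sdiff, Set.mem_Icc, Set.mem_singleton_iff]
    refine ⟨⟨?_, ?_⟩, ?_⟩
    · rw [norm_frac_sub] at hn
      have e : ((k (p, s) : ℤ) : ℝ) = (g * q' * r') *
        ((p : ℝ) / ((q' * g : ℕ) : ℝ) - (s : ℝ) / ((r' * g : ℕ) : ℝ) - (t (p, s) : ℤ)) := by
        simp only [k]
        push_cast
        field_simp
      have h3 : |((k (p, s) : ℤ) : ℝ)| < X := by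
        rw [e, abs_mul, abs_of_pos (by positivity), hX]
        exact mul_lt_mul_of_pos_left hn (by positivity)
      have h4 : (k (p, s)).natAbs ≤ M := by
        apply Nat.le_floor
        rw [Nat.cast_natAbs, Int.cast_abs]
        exact h3.le
      omega
    · intro h0
      simp only [k] at h0
      have d1 : q' ∣ p := by
        have : (q' : ℤ) ∣ p * r' := ⟨s + t (p, s) * (g * r'), by linarith⟩
        have : q' ∣ p * r' := by exact_mod_cast this
        exact hcop.dvd_of_dvd_mul_right this
      have d2 : r' ∣ s := by
        have : (r' : ℤ) ∣ s * q' := ⟨p - t (p, s) * (g * q'), by linarith⟩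
        have : r' ∣ s * q' := by exact_mod_cast this
        exact hcop.symm.dvd_of_dvd_mul_right this
      have e1 : q' = 1 := Nat.dvd_one.1 (hp2 ▸ Nat.dvd_gcd d1 (Dvd.intro _ rfl))
      have e2 : r' = 1 := Nat.dvd_one.1 (hs2 ▸ Nat.dvd_gcd d2 (Dvd.intro _ rfl))
      exact hqr (by rw [e1, e2])
    · exact Nat.div_lt_of_lt_mul hp1
  · rintro ⟨p, s⟩ hz ⟨p2, s2⟩ hz2 heq
    simp only [Finset.coe_filter, Finset.mem_product, redSet, Finset.mem_filter, Finset.mem_range,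
      mem_ofPred_eq] at hz hz2
    obtain ⟨⟨⟨hp1, -⟩, hs1, -⟩, -⟩ := hz
    obtain ⟨⟨⟨hp1', -⟩, hs1', -⟩, -⟩ := hz2
    simp only [Prod.mk.injEq, k] at heq
    obtain ⟨hk, hd⟩ := heq
    generalize t (p, s) = t1 at hk
    generalize t (p2, s2) = t2 at hk
    have d1 : (q' : ℤ) ∣ (p : ℤ) - p2 := by
      have : (q' : ℤ) ∣ ((p : ℤ) - p2) * r' := ⟨s - s2 + (t1 - t2) * (g * r'), by linarith⟩
      exact (Nat.isCoprime_iff_coprime.2 hcop).dvd_of_dvd_mul_right this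
    have hmod : p2 % q' = p % q' := (Nat.modEq_iff_dvd.2 d1)
    have hp : p = p2 := by
      rw [← Nat.div_add_mod p q', ← Nat.div_add_mod p2 q', hd, hmod]
    subst hp
    have h5 : (q' : ℤ) * (s - s2 + (t1 - t2) * (g * r')) = 0 := by linarith
    have h6 : (s : ℤ) - s2 + (t1 - t2) * (g * r') = 0 := by
      rcases mul_eq_zero.1 h5 with h | h
      · omega
      · exact h
    have h7 : ((r' * g : ℕ) : ℤ) ∣ (s : ℤ) - s2 := ⟨-(t1 - t2), by push_cast; linarith⟩
    have h8 : s2 % (r' * g) = s % (r' * g) := Nat.modEq_iff_dvd.2 h7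
    rw [Nat.mod_eq_of_lt hs1, Nat.mod_eq_of_lt hs1'] at h8
    rw [h8]

def Aset (n : ℕ) (δ : ℝ) : Set UnitAddCircle :=
  ⋃ p ∈ redSet n, Metric.ball (((p : ℝ) / n : ℝ) : UnitAddCircle) δ

lemma measurable_Aset (n : ℕ) (δ : ℝ) : MeasurableSet (Aset n δ) :=
  Finset.measurableSet_biUnion _ fun _ _ => Metric.isOpen_ball.measurableSet

lemma vol_ball_le (x : UnitAddCircle) (δ : ℝ) (hδ : 0 ≤ δ) :
    volume.real (Metric.ball x δ) ≤ 2 * δ := by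
  have h1 : volume.real (Metric.ball x δ) ≤ volume.real (Metric.closedBall x δ) :=
    measureReal_mono Metric.ball_subset_closedBall
  refine h1.trans ?_
  rw [measureReal_def, AddCircle.volume_closedBall, ENNReal.toReal_ofReal (by positivity)]
  exact min_le_right _ _

lemma Aset_upper (n : ℕ) (δ : ℝ) (hδ : 0 ≤ δ) : volume.real (Aset n δ) ≤ 2 * n * δ := by
  have h1 : volume.real (Aset n δ) ≤ ∑ p ∈ redSet n,
      volume.real (Metric.ball (((p : ℝ) / n : ℝ) : UnitAddCircle) δ) :=
    measureReal_biUnion_finset_le _ _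
  refine h1.trans ((Finset.sum_le_card_nsmul _ _ (2 * δ) fun p _ => vol_ball_le _ _ hδ).trans ?_)
  rw [card_redSet, nsmul_eq_mul]
  have : (Nat.totient n : ℝ) ≤ n := by exact_mod_cast Nat.totient_le n
  nlinarith

lemma Aset_lower (n : ℕ) (hn : 0 < n) (δ : ℝ) (hδ : 0 < δ) (h1 : δ * n < 1) :
    Nat.totient n * δ ≤ volume.real (Aset n δ) := by
  have hn' : (0 : ℝ) < n := by exact_mod_cast hn
  have hn1 : (1 : ℝ) ≤ n := by exact_mod_cast hn
  have hsub : (⋃ p ∈ redSet n, Metric.closedBall (((p : ℝ) / n : ℝ) : UnitAddCircle) (δ / 2)) ⊆ Aset n δ := by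
    apply Set.iUnion₂_mono
    intro p _
    exact Metric.closedBall_subset_ball (by linarith)
  have hdisj : PairwiseDisjoint (redSet n : Set ℕ)
      (fun p : ℕ => Metric.closedBall (((p : ℝ) / n : ℝ) : UnitAddCircle) (δ / 2)) := by
    intro p hp p2 hp2 hne
    apply Metric.closedBall_disjoint_closedBall
    rw [dist_eq_norm, norm_frac_sub]
    generalize round ((p : ℝ) / n - (p2 : ℝ) / n) = t
    have e : (p : ℝ) / n - p2 / n - (t : ℤ) = (((p : ℤ) - p2 - t * n : ℤ) : ℝ) / n := by
      push_cast; field_simp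
    rw [e, abs_div, abs_of_pos hn', lt_div_iff₀ hn']
    have hk : ((p : ℤ) - p2 - t * n) ≠ 0 := by
      intro h0
      simp only [redSet, Finset.coe_filter, Finset.mem_range, mem_ofPred_eq] at hp hp2
      have h7 : (n : ℤ) ∣ (p : ℤ) - p2 := ⟨t, by linarith⟩
      have h8 : p2 % n = p % n := Nat.modEq_iff_dvd.2 h7
      rw [Nat.mod_eq_of_lt hp.1, Nat.mod_eq_of_lt hp2.1] at h8
      exact hne h8.symm
    have : (1 : ℝ) ≤ |(((p : ℤ) - p2 - t * n : ℤ) : ℝ)| := by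
      rw [← Int.cast_abs]; exact_mod_cast Int.one_le_abs hk
    linarith
  have h2 := measureReal_mono (μ := volume) hsub
  rw [measureReal_biUnion_finset hdisj (fun _ _ => Metric.isClosed_closedBall.measurableSet)] at h2
  have h3 : ∀ p ∈ redSet n, volume.real (Metric.closedBall (((p : ℝ) / n : ℝ) : UnitAddCircle) (δ / 2)) = δ := by
    intro p _
    rw [measureReal_def, AddCircle.volume_closedBall, ENNReal.toReal_ofReal (by positivity)]
    rw [min_eq_right] <;> nlinarith
  rw [Finset.sum_congr rfl h3, Finset.sum_const, card_redSet, nsmul_eq_mul] at h2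
  exact h2

lemma Aset_inter (q r : ℕ) (hq : 0 < q) (hr : 0 < r) (hqr : q ≠ r) (δ δ' : ℝ) (hδ : 0 ≤ δ) (hδ' : 0 ≤ δ') :
    volume.real (Aset q δ ∩ Aset r δ') ≤ 8 * (q * δ) * (r * δ') := by
  classical
  set S := ((redSet q) ×ˢ (redSet r)).filter (fun z =>
      ‖(((z.1 : ℝ) / q : ℝ) : UnitAddCircle) - (((z.2 : ℝ) / r : ℝ) : UnitAddCircle)‖ < δ + δ') with hS
  have hsub : Aset q δ ∩ Aset r δ' ⊆ ⋃ z ∈ S, (Metric.ball (((z.1 : ℝ) / q : ℝ) : UnitAddCircle) δ ∩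
      Metric.ball (((z.2 : ℝ) / r : ℝ) : UnitAddCircle) δ') := by
    rintro x ⟨hx1, hx2⟩
    simp only [Aset, mem_iUnion, exists_prop] at hx1 hx2
    obtain ⟨p, hp, hp'⟩ := hx1
    obtain ⟨s, hs, hs'⟩ := hx2
    refine Set.mem_biUnion (x := (p, s)) ?_ ⟨hp', hs'⟩
    simp only [hS, Finset.coe_filter, Finset.mem_product, mem_ofPred_eq]
    refine ⟨⟨hp, hs⟩, ?_⟩
    rw [← dist_eq_norm]
    rw [Metric.mem_ball] at hp' hs'
    calc _ ≤ _ := dist_triangle_left _ _ x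
      _ < _ := add_lt_add hp' hs'
  have h1 := (measureReal_mono (μ := volume) hsub (measure_ne_top _ _)).trans (measureReal_biUnion_finset_le _ _)
  have h2 : ∀ z ∈ S, volume.real (Metric.ball (((z.1 : ℝ) / q : ℝ) : UnitAddCircle) δ ∩
      Metric.ball (((z.2 : ℝ) / r : ℝ) : UnitAddCircle) δ') ≤ 2 * min δ δ' := by
    intro z _
    rw [mul_min_of_nonneg _ _ (by norm_num : (0 : ℝ) ≤ 2)]
    exact le_min ((measureReal_mono Set.inter_subset_left).trans (vol_ball_le _ _ hδ))
      ((measureReal_mono Set.inter_subset_right).trans (vol_ball_le _ _ hδ'))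
  refine h1.trans ((Finset.sum_le_card_nsmul _ _ _ h2).trans ?_)
  rw [nsmul_eq_mul]
  have h3 := pair_count q r hq hr hqr (δ + δ') (by positivity)
  have h4 : (0 : ℝ) ≤ 2 * min δ δ' := by positivity
  refine (mul_le_mul_of_nonneg_right h3 h4).trans ?_
  have h5 : (δ + δ') * min δ δ' ≤ 2 * (δ * δ') := by
    rcases le_total δ δ' with h | h
    · rw [min_eq_left h]; nlinarith
    · rw [min_eq_right h]; nlinarith
  have h6 : (0 : ℝ) ≤ (q : ℝ) * r := by positivity
  nlinarith [mul_le_mul_of_nonneg_left h5 h6]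

lemma khin_lower (f : ℕ → ℝ) (hanti : ∀ n, 1 ≤ n → f (n + 1) ≤ f n) (hpos : ∀ n, 1 ≤ n → 0 < f n)
    (hlim : Filter.Tendsto f Filter.atTop (nhds 0)) (hns : ¬ Summable (fun n : ℕ => f (n + 1)))
    (Q : ℕ) : ∃ s : Finset ℕ, (∀ n ∈ s, Q ≤ n ∧ 1 ≤ n) ∧
      (1 : ℝ) / 640 ≤ volume.real (⋃ n ∈ s, Aset n (f n / n)) := by
  obtain ⟨q1, hq1⟩ := Filter.eventually_atTop.1 (hlim.eventually (gt_mem_nhds (zero_lt_one)))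
  set q0 := max (max Q 1) q1 with hq0
  have hT : Filter.Tendsto (fun n => ∑ i ∈ Finset.range n, f (i + 1)) Filter.atTop Filter.atTop :=
    (not_summable_iff_tendsto_nat_atTop_of_nonneg (fun n => (hpos _ (by omega)).le)).1 hns
  set K := ∑ n ∈ Finset.Ico 1 q0, f n with hK
  obtain ⟨N, hN1, hN2⟩ := ((hT.eventually_ge_atTop (max 1 (8 * K))).and
    (Filter.eventually_ge_atTop q0)).exists
  have hS : ∑ i ∈ Finset.range N, f (i + 1) = ∑ n ∈ Finset.Icc 1 N, f n := by
    rw [Finset.range_eq_Ico, Finset.sum_Ico_add' f 0 N 1]; rfl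
  rw [hS] at hN1
  set S := ∑ n ∈ Finset.Icc 1 N, f n with hSdef
  have hS1 : 1 ≤ S := (le_max_left _ _).trans hN1
  have hSK : 8 * K ≤ S := (le_max_right _ _).trans hN1
  have hq0n : ∀ n ∈ Finset.Icc q0 N, q0 ≤ n ∧ 1 ≤ n ∧ n ≤ N := by
    intro n hn
    rw [Finset.mem_Icc] at hn
    exact ⟨hn.1, by omega, hn.2⟩
  refine ⟨Finset.Icc q0 N, fun n hn => ⟨by have := hq0n n hn; omega, (hq0n n hn).2.1⟩, ?_⟩
  have hsplit : ∀ g : ℕ → ℝ, ∑ n ∈ Finset.Icc 1 N, g n =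
      ∑ n ∈ Finset.Ico 1 q0, g n + ∑ n ∈ Finset.Icc q0 N, g n := by
    intro g
    have := Finset.sum_Ico_consecutive g (m := 1) (n := q0) (k := N + 1) (by omega) (by omega)
    exact this.symm
  have hlow : S / 8 ≤ ∑ n ∈ Finset.Icc q0 N, volume.real (Aset n (f n / n)) := by
    have h1 : ∑ n ∈ Finset.Icc q0 N, f n * ((Nat.totient n : ℝ) / n) ≤
        ∑ n ∈ Finset.Icc q0 N, volume.real (Aset n (f n / n)) := by
      apply Finset.sum_le_sum
      intro n hn
      obtain ⟨ha, hb, hc⟩ := hq0n n hn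
      have hn0 : (0 : ℝ) < n := by exact_mod_cast hb
      have := Aset_lower n hb (f n / n) (div_pos (hpos n hb) hn0) (by
        rw [div_mul_cancel₀ _ hn0.ne']; exact hq1 n (by omega))
      refine le_trans (le_of_eq ?_) this
      ring
    have h2 := sum_psi_totient f hanti (fun n hn => (hpos n hn).le) N
    rw [hsplit (fun q => f q * ((Nat.totient q : ℝ) / q))] at h2
    have h3 : ∑ n ∈ Finset.Ico 1 q0, f n * ((Nat.totient n : ℝ) / n) ≤ K := by
      apply Finset.sum_le_sum
      intro n hn
      rw [Finset.mem_Ico] at hn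
      have hn0 : (0 : ℝ) < n := by exact_mod_cast hn.1
      have : (Nat.totient n : ℝ) / n ≤ 1 := by
        rw [div_le_one hn0]; exact_mod_cast Nat.totient_le n
      have := hpos n hn.1
      nlinarith
    linarith
  have hupS : ∑ n ∈ Finset.Icc q0 N, f n ≤ S := by
    rw [hSdef, hsplit f]
    have : 0 ≤ ∑ n ∈ Finset.Ico 1 q0, f n :=
      Finset.sum_nonneg fun n hn => (hpos n (Finset.mem_Ico.1 hn).1).le
    linarith
  have hupS0 : 0 ≤ ∑ n ∈ Finset.Icc q0 N, f n :=
      Finset.sum_nonneg fun n hn => (hpos n (hq0n n hn).2.1).le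
  have hup : ∑ i ∈ Finset.Icc q0 N, ∑ j ∈ Finset.Icc q0 N,
      volume.real (Aset i (f i / i) ∩ Aset j (f j / j)) ≤ 10 * S ^ 2 := by
    have h1 : ∀ i ∈ Finset.Icc q0 N, ∀ j ∈ Finset.Icc q0 N,
        volume.real (Aset i (f i / i) ∩ Aset j (f j / j)) ≤
          8 * f i * f j + (if i = j then 2 * f i else 0) := by
      intro i hi j hj
      obtain ⟨-, hi1, -⟩ := hq0n i hi
      obtain ⟨-, hj1, -⟩ := hq0n j hj
      have hi0 : (0 : ℝ) < i := by exact_mod_cast hi1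
      have hj0 : (0 : ℝ) < j := by exact_mod_cast hj1
      have hfi := hpos i hi1
      have hfj := hpos j hj1
      split_ifs with h
      · subst h
        rw [Set.inter_self]
        have := Aset_upper i (f i / i) (by positivity)
        have e : 2 * (i : ℝ) * (f i / i) = 2 * f i := by field_simp
        rw [e] at this
        have : 0 < 8 * f i * f i := by positivity
        linarith
      · have := Aset_inter i j hi1 hj1 h (f i / i) (f j / j) (by positivity) (by positivity)
        have e : 8 * ((i : ℝ) * (f i / i)) * (j * (f j / j)) = 8 * f i * f j := by field_simp
        linarith
    have h2 := Finset.sum_le_sum fun i hi => Finset.sum_le_sum (h1 i hi)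
    refine h2.trans ?_
    simp only [Finset.sum_add_distrib, Finset.sum_ite_eq]
    have e1 : ∑ i ∈ Finset.Icc q0 N, ∑ j ∈ Finset.Icc q0 N, 8 * f i * f j =
        8 * (∑ i ∈ Finset.Icc q0 N, f i) ^ 2 := by
      rw [sq, Finset.sum_mul_sum, Finset.mul_sum]
      refine Finset.sum_congr rfl fun i _ => ?_
      rw [Finset.mul_sum]
      exact Finset.sum_congr rfl fun j _ => by ring
    have e2 : ∑ i ∈ Finset.Icc q0 N, (if i ∈ Finset.Icc q0 N then 2 * f i else 0) =
        2 * ∑ i ∈ Finset.Icc q0 N, f i := by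
      rw [Finset.mul_sum]
      exact Finset.sum_congr rfl fun i hi => by rw [if_pos hi]
    rw [e1, e2]
    nlinarith
  have hce := chung_erdos (volume : Measure UnitAddCircle) (Finset.Icc q0 N)
    (fun n => Aset n (f n / n)) (fun n => measurable_Aset _ _)
  have h0 : 0 ≤ volume.real (⋃ n ∈ Finset.Icc q0 N, Aset n (f n / n)) := measureReal_nonneg
  have h3 : (S / 8) ^ 2 ≤ volume.real (⋃ n ∈ Finset.Icc q0 N, Aset n (f n / n)) * (10 * S ^ 2) := by
    calc (S / 8) ^ 2 ≤ (∑ n ∈ Finset.Icc q0 N, volume.real (Aset n (f n / n))) ^ 2 := by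
          gcongr
      _ ≤ _ := hce
      _ ≤ _ := by gcongr
  have hS2 : 0 < S ^ 2 := by positivity
  by_contra hcon
  push Not at hcon
  nlinarith

theorem khinchine_div (f : ℕ → ℝ) (hanti : ∀ n, 1 ≤ n → f (n + 1) ≤ f n) (hpos : ∀ n, 1 ≤ n → 0 < f n)
    (hlim : Filter.Tendsto f Filter.atTop (nhds 0)) (hns : ¬ Summable (fun n : ℕ => f (n + 1))) :
    ∀ᵐ x : UnitAddCircle, x ∈ addWellApproximable UnitAddCircle (fun n => f n / n) := by
  have hδ : Filter.Tendsto (fun n : ℕ => f n / n) Filter.atTop (nhds 0) := by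
    refine tendsto_of_tendsto_of_tendsto_of_le_of_le' tendsto_const_nhds hlim ?_ ?_
    · filter_upwards [Filter.eventually_ge_atTop 1] with n hn
      exact div_nonneg (hpos n hn).le (Nat.cast_nonneg n)
    · filter_upwards [Filter.eventually_ge_atTop 1] with n hn
      exact div_le_self (hpos n hn).le (by exact_mod_cast hn)
  rcases AddCircle.addWellApproximable_ae_empty_or_univ (T := (1 : ℝ)) _ hδ with h | h
  swap
  · exact h
  exfalso
  let B : ℕ → Set UnitAddCircle := fun Q => ⋃ n ∈ {n : ℕ | Q ≤ n ∧ 1 ≤ n}, Aset n (f n / n)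
  have hBm : ∀ Q, MeasurableSet (B Q) := fun Q =>
    MeasurableSet.biUnion (Set.to_countable _) fun n _ => measurable_Aset _ _
  have hBanti : Antitone B := by
    intro Q Q' hQ
    apply Set.biUnion_subset_biUnion_left
    rintro n ⟨h1, h2⟩
    exact ⟨hQ.trans h1, h2⟩
  have hBge : ∀ Q, ENNReal.ofReal (1 / 640) ≤ volume (B Q) := by
    intro Q
    obtain ⟨s, hs, hv⟩ := khin_lower f hanti hpos hlim hns Q
    have : volume.real (⋃ n ∈ s, Aset n (f n / n)) ≤ volume.real (B Q) := by
      apply measureReal_mono _ (measure_ne_top _ _)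
      exact Set.biUnion_subset_biUnion_left (fun n hn => hs n hn)
    rw [← ofReal_measureReal (measure_ne_top _ _)]
    exact ENNReal.ofReal_le_ofReal (hv.trans this)
  have hlimB := tendsto_measure_iInter_atTop (μ := (volume : Measure UnitAddCircle))
    (fun Q => (hBm Q).nullMeasurableSet) hBanti ⟨0, measure_ne_top _ _⟩
  have hge : ENNReal.ofReal (1 / 640) ≤ volume (⋂ Q, B Q) :=
    ge_of_tendsto' hlimB hBge
  have hsub : (⋂ Q, B Q) ⊆ {x | ¬ x ∉ addWellApproximable UnitAddCircle (fun n : ℕ => f n / n)} := by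
    intro x hx
    rw [Set.mem_iInter] at hx
    simp only [not_not, mem_ofPred_eq]
    rw [UnitAddCircle.mem_addWellApproximable_iff, ← Nat.frequently_atTop_iff_infinite,
      Filter.frequently_atTop]
    intro Q
    have := hx Q
    simp only [B, Aset, mem_iUnion, exists_prop, mem_ofPred_eq] at this
    obtain ⟨n, ⟨hn1, hn2⟩, p, hp, hb⟩ := this
    simp only [redSet, Finset.mem_filter, Finset.mem_range] at hp
    exact ⟨n, hn1, p, hp.1, hp.2, by rwa [Metric.mem_ball, dist_eq_norm] at hb⟩
  have hz : volume (⋂ Q, B Q) = 0 := measure_mono_null hsub (ae_iff.1 h)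
  rw [hz] at hge
  norm_num at hge

def GPsi (Ψ : ℝ → ℝ) (Q₁ Q₂ : ℕ) : Set ℝ :=
  ⋃ q ∈ Finset.Ico Q₁ Q₂, ⋃ p ∈ Finset.range (q + 1),
    Set.Ioo ((p : ℝ) / q - Ψ q / q) ((p : ℝ) / q + Ψ q / q)

def KPsi (Ψ : ℝ → ℝ) (Q₁ Q₂ : ℕ) : Set ℝ := Set.Icc 0 1 \ GPsi Ψ Q₁ Q₂

lemma isOpen_GPsi (Ψ : ℝ → ℝ) (Q₁ Q₂ : ℕ) : IsOpen (GPsi Ψ Q₁ Q₂) :=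
  isOpen_biUnion fun _ _ => isOpen_biUnion fun _ _ => isOpen_Ioo

lemma isCompact_KPsi (Ψ : ℝ → ℝ) (Q₁ Q₂ : ℕ) : IsCompact (KPsi Ψ Q₁ Q₂) :=
  isCompact_Icc.diff (isOpen_GPsi Ψ Q₁ Q₂)

lemma khin_real (Ψ : ℝ → ℝ) (hΨ : IsApproxFun Ψ)
    (hns : ¬ Summable (fun q : ℕ => Ψ ((q : ℝ) + 1))) :
    ∀ᶠ Q₁ : ℕ in Filter.atTop,
      Filter.Tendsto (fun Q₂ : ℕ => volume (KPsi Ψ Q₁ Q₂)) Filter.atTop (nhds 0) := by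
  obtain ⟨hpos, hanti, hlim⟩ := hΨ
  have hlim' : Filter.Tendsto (fun n : ℕ => Ψ n) Filter.atTop (nhds 0) :=
    hlim.comp tendsto_natCast_atTop_atTop
  have hk := khinchine_div (fun n : ℕ => Ψ n) (fun n hn => by
      have : (0 : ℝ) < n := by exact_mod_cast hn
      apply hanti this
      · simp only [Set.mem_Ioi]; positivity
      · push_cast; linarith) (fun n hn => hpos _ (by exact_mod_cast hn)) hlim' (by
      simpa using hns)
  filter_upwards [(Filter.eventually_atTop.1 (hlim'.eventually (gt_mem_nhds (zero_lt_one)))).choose_spec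
    |> fun h => Filter.eventually_atTop.2 ⟨_, fun Q hQ n (hn : Q ≤ n) => h n (hQ.trans hn)⟩,
    Filter.eventually_ge_atTop 1] with Q₁ hQ1 hQ1'
  have hanti2 : Antitone (fun Q₂ : ℕ => KPsi Ψ Q₁ Q₂) := by
    intro a b hab
    apply Set.sdiff_subset_sdiff_right
    apply Set.biUnion_subset_biUnion_left
    intro q hq
    simp only [Finset.coe_Ico, Set.mem_Ico] at hq ⊢
    exact ⟨hq.1, hq.2.trans_le hab⟩
  have hlimK := tendsto_measure_iInter_atTop (μ := (volume : Measure ℝ))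
    (fun Q => (isCompact_KPsi Ψ Q₁ Q).measurableSet.nullMeasurableSet) hanti2
    ⟨0, (isCompact_KPsi Ψ Q₁ 0).measure_lt_top.ne⟩
  suffices h : volume (⋂ Q₂, KPsi Ψ Q₁ Q₂) = 0 by rwa [h] at hlimK
  have hpull : ∀ᵐ x : ℝ ∂(volume.restrict (Ioc (0 : ℝ) (0 + 1))),
      (x : UnitAddCircle) ∈ addWellApproximable UnitAddCircle (fun n : ℕ => Ψ n / n) :=
    (AddCircle.measurePreserving_mk 1 0).quasiMeasurePreserving.ae hk
  rw [ae_restrict_iff' measurableSet_Ioc] at hpull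
  rw [zero_add] at hpull
  have hsub : (⋂ Q₂, KPsi Ψ Q₁ Q₂) ⊆ {0} ∪ {x : ℝ | ¬ (x ∈ Ioc (0 : ℝ) 1 → (x : UnitAddCircle) ∈
      addWellApproximable UnitAddCircle (fun n : ℕ => Ψ n / n))} := by
    intro x hx
    rw [Set.mem_iInter] at hx
    have hx01 : x ∈ Set.Icc (0 : ℝ) 1 := (hx 0).1
    by_cases hx0 : x = 0
    · left; exact hx0
    right
    simp only [mem_ofPred_eq]
    intro hcon
    have hw := hcon ⟨lt_of_le_of_ne hx01.1 (Ne.symm hx0), hx01.2⟩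
    rw [UnitAddCircle.mem_addWellApproximable_iff, ← Nat.frequently_atTop_iff_infinite,
      Filter.frequently_atTop] at hw
    obtain ⟨n, hn, m, hm, -, hnorm⟩ := hw Q₁
    have hn0 : (0 : ℝ) < n := by exact_mod_cast (by omega : 0 < n)
    have e : ((x : UnitAddCircle) - (((m : ℝ) / n : ℝ) : UnitAddCircle)) = ((x - (m : ℝ) / n : ℝ) : UnitAddCircle) := rfl
    rw [e, UnitAddCircle.norm_eq] at hnorm
    generalize round (x - (m : ℝ) / n) = t at hnorm
    have hΨ1 : Ψ n < 1 := hQ1 n hn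
    have e2 : x - (m : ℝ) / n - t = (x * n - ((m : ℤ) + t * n : ℤ)) / n := by
      push_cast; field_simp; ring
    rw [e2, abs_div, abs_of_pos hn0, div_lt_div_iff_of_pos_right hn0, abs_lt] at hnorm
    generalize ((m : ℤ) + t * n) = p at hnorm
    have hp0 : 0 ≤ p := by
      have : (-1 : ℝ) < p := by
        have : 0 ≤ x * n := mul_nonneg hx01.1 hn0.le
        linarith
      have : (-1 : ℤ) < p := by exact_mod_cast this
      omega
    have hpn : p ≤ n := by
      have : (p : ℝ) < n + 1 := by
        have : x * n ≤ n := mul_le_of_le_one_left hn0.le hx01.2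
        linarith
      have : p < (n : ℤ) + 1 := by exact_mod_cast this
      omega
    obtain ⟨p, rfl⟩ := Int.eq_ofNat_of_zero_le hp0
    apply (hx (n + 1)).2
    simp only [GPsi, mem_iUnion, exists_prop, Finset.mem_Ico, Finset.mem_range, Set.mem_Ioo]
    refine ⟨n, ⟨hn, by omega⟩, p, by omega, ?_, ?_⟩
    · rw [← sub_div, div_lt_iff₀ hn0]
      have := hnorm.1
      push_cast at this
      linarith
    · rw [← add_div, lt_div_iff₀ hn0]
      have := hnorm.2
      push_cast at this
      linarith
  refine measure_mono_null hsub ?_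
  rw [measure_union_null_iff]
  exact ⟨by simp, ae_iff.1 hpull⟩

def coefBox (d H : ℕ) : Finset (Fin (d + 1) → ℤ) :=
  Fintype.piFinset (fun _ => Finset.Icc (-(H : ℤ)) H)

lemma count_linear (d H : ℕ) (j : Fin (d + 1)) (c : Fin (d + 1) → ℝ) (hc : c j = 1) (B : ℝ)
    (hB : 0 ≤ B) :
    (((coefBox d H).filter (fun v => |∑ i, c i * (v i : ℝ)| ≤ B)).card : ℝ) ≤
      (2 * H + 1) ^ d * (2 * B + 1) := by
  classical
  set S := (coefBox d H).filter (fun v => |∑ i, c i * (v i : ℝ)| ≤ B) with hS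
  let f : (Fin (d + 1) → ℤ) → (Fin d → ℤ) := fun v i => v (j.succAbove i)
  have h1 : S.card ≤ (⌊2 * B⌋₊ + 1) * (S.image f).card := by
    apply Finset.card_le_mul_card_image
    intro w _
    set x : ℝ := ∑ i, c (j.succAbove i) * (w i : ℝ) with hx
    have hle : ({v ∈ S | f v = w}).card ≤ (Finset.Icc ⌈-B - x⌉ ⌊B - x⌋).card := by
      apply Finset.card_le_card_of_injOn (fun v => v j)
      · intro v hv
        simp only [Finset.coe_filter, mem_ofPred_eq, hS, Finset.mem_filter] at hv
        obtain ⟨⟨-, h2⟩, h3⟩ := hv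
        rw [Fin.sum_univ_succAbove _ j, hc, one_mul] at h2
        have h4 : ∑ i, c (j.succAbove i) * (v (j.succAbove i) : ℝ) = x := by
          rw [hx, ← h3]
        rw [h4, abs_le] at h2
        simp only [Finset.coe_Icc, Set.mem_Icc]
        exact ⟨Int.ceil_le.2 (by linarith), Int.le_floor.2 (by linarith)⟩
      · intro v hv v' hv' heq
        simp only [Finset.coe_filter, mem_ofPred_eq] at hv hv'
        funext i
        rcases Fin.eq_self_or_eq_succAbove j i with h | ⟨k, rfl⟩
        · rw [h]; exact heq
        · exact congrFun (hv.2.trans hv'.2.symm) k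
    refine hle.trans ?_
    rw [Int.card_Icc]
    have h5 : ⌊B - x⌋ - ⌈-B - x⌉ ≤ (⌊2 * B⌋₊ : ℤ) := by
      rw [Int.natCast_floor_eq_floor (by positivity)]
      apply Int.le_floor.2
      push_cast
      have := Int.floor_le (B - x)
      have := Int.le_ceil (-B - x)
      linarith
    omega
  have h2 : (S.image f).card ≤ (2 * H + 1) ^ d := by
    have : (S.image f) ⊆ Fintype.piFinset (fun _ : Fin d => Finset.Icc (-(H : ℤ)) H) := by
      intro w hw
      obtain ⟨v, hv, rfl⟩ := Finset.mem_image.1 hw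
      rw [hS, Finset.mem_filter, coefBox, Fintype.mem_piFinset] at hv
      rw [Fintype.mem_piFinset]
      intro i
      exact hv.1 _
    refine (Finset.card_le_card this).trans ?_
    rw [Fintype.card_piFinset]
    simp only [Int.card_Icc, Finset.prod_const, Finset.card_univ, Fintype.card_fin]
    apply le_of_eq
    congr 1
    omega
  have h3 : ((⌊2 * B⌋₊ : ℕ) : ℝ) ≤ 2 * B := Nat.floor_le (by positivity)
  calc (S.card : ℝ) ≤ (((⌊2 * B⌋₊ + 1) * (S.image f).card : ℕ) : ℝ) := by exact_mod_cast h1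
    _ = (((⌊2 * B⌋₊ : ℕ) : ℝ) + 1) * (S.image f).card := by push_cast; ring
    _ ≤ (2 * B + 1) * (2 * H + 1) ^ d := by
        have : ((S.image f).card : ℝ) ≤ (2 * H + 1) ^ d := by exact_mod_cast h2
        gcongr
    _ = _ := by ring

lemma count_alg (d H : ℕ) (j : Fin (d + 1)) (c : Fin (d + 1) → ℝ) (hc : c j = 1) (B : ℝ)
    (hB : 0 ≤ B) (A : Set ℝ) (hA : A ⊆ algSet d H)
    (h : ∀ α ∈ A, ∀ v : Fin (d + 1) → ℤ, (∀ i, |(v i : ℝ)| ≤ H) →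
      ∑ i, (v i : ℝ) * α ^ (i : ℕ) = 0 → |∑ i, c i * (v i : ℝ)| ≤ B) :
    A.Finite ∧ (A.ncard : ℝ) ≤ d * ((2 * H + 1) ^ d * (2 * B + 1)) := by
  classical
  set S := (coefBox d H).filter (fun v => |∑ i, c i * (v i : ℝ)| ≤ B) with hS
  let P : (Fin (d + 1) → ℤ) → Polynomial ℝ := fun v => ∑ i : Fin (d + 1), Polynomial.monomial (i : ℕ) (v i : ℝ)
  let T : Finset ℝ := S.biUnion (fun v => (P v).roots.toFinset)
  have hT : T.card ≤ S.card * d := by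
    apply Finset.card_biUnion_le_card_mul
    intro v _
    refine (Multiset.toFinset_card_le _).trans ((Polynomial.card_roots' _).trans ?_)
    apply Polynomial.natDegree_sum_le_of_forall_le
    intro i _
    exact (Polynomial.natDegree_monomial_le _).trans (by omega)
  have hAT : A ⊆ (T : Set ℝ) := by
    intro α hα
    obtain ⟨p, hirr, hdeg, hcoef, hroot⟩ := hA hα
    let v : Fin (d + 1) → ℤ := fun i => p.coeff i
    have hPv : P v = p.map (Int.castRingHom ℝ) := by
      ext n
      simp only [P, Polynomial.finsetSum_coeff, Polynomial.coeff_monomial, Polynomial.coeff_map, v]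
      by_cases hn : n < d + 1
      · rw [Finset.sum_eq_single (⟨n, hn⟩ : Fin (d + 1))]
        · simp
        · intro b _ hb
          rw [if_neg]
          intro h; exact hb (Fin.ext h)
        · simp
      · rw [Finset.sum_eq_zero, Polynomial.coeff_eq_zero_of_natDegree_lt (by omega)]
        · simp
        · intro i _
          rw [if_neg (by omega)]
    have hne : P v ≠ 0 := by
      rw [hPv, Polynomial.map_ne_zero_iff (RingHom.injective_int _)]
      exact hirr.ne_zero
    have hev : (P v).eval α = 0 := by
      rw [hPv, Polynomial.eval_map]
      exact hroot
    have hsum : ∑ i, (v i : ℝ) * α ^ (i : ℕ) = 0 := by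
      simpa [P, Polynomial.eval_finsetSum, Polynomial.eval_monomial] using hev
    rw [Finset.mem_coe, Finset.mem_biUnion]
    refine ⟨v, ?_, ?_⟩
    · rw [hS, Finset.mem_filter]
      refine ⟨?_, h α hα v (fun i => hcoef i) hsum⟩
      rw [coefBox, Fintype.mem_piFinset]
      intro i
      have := hcoef i
      rw [← Int.cast_abs] at this
      have : |p.coeff i| ≤ (H : ℤ) := by exact_mod_cast this
      rw [abs_le] at this
      exact Finset.mem_Icc.2 this
    · rw [Multiset.mem_toFinset, Polynomial.mem_roots hne]
      exact hev
  refine ⟨T.finite_toSet.subset hAT, ?_⟩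
  have h1 : A.ncard ≤ T.card := by
    rw [← Set.ncard_coe_finset]
    exact Set.ncard_le_ncard hAT T.finite_toSet
  have h2 := count_linear d H j c hc B hB
  calc (A.ncard : ℝ) ≤ ((S.card * d : ℕ) : ℝ) := by exact_mod_cast h1.trans hT
    _ = d * (S.card : ℝ) := by push_cast; ring
    _ ≤ _ := by gcongr

lemma algSet_finite (d H : ℕ) : (algSet d H).Finite := by
  refine (count_alg d H 0 (fun i => if i = 0 then 1 else 0) (by simp) H (by positivity)
    (algSet d H) subset_rfl ?_).1
  intro α _ v hv _
  simpa using hv 0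

lemma count_interval (d H : ℕ) (a b R : ℝ) (hab : a ≤ b) (hR : 1 ≤ R) (ha : -R ≤ a) (hb : b ≤ R) :
    ((algSet d H ∩ Icc a b).ncard : ℝ) ≤
      d * ((2 * H + 1) ^ d * (2 * ((b - a) * H * ((d + 1) * d * R ^ d)) + 1)) := by
  have hba : 0 ≤ b - a := by linarith
  refine (count_alg d H 0 (fun i => a ^ (i : ℕ)) (by simp) _ (by positivity)
    (algSet d H ∩ Icc a b) inter_subset_left ?_).2
  rintro α ⟨-, hα⟩ v hv hs
  have e : ∑ i : Fin (d + 1), a ^ (i : ℕ) * (v i : ℝ) =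
      ∑ i : Fin (d + 1), (a ^ (i : ℕ) - α ^ (i : ℕ)) * (v i : ℝ) := by
    simp_rw [sub_mul]
    rw [Finset.sum_sub_distrib]
    have : ∑ i : Fin (d + 1), α ^ (i : ℕ) * (v i : ℝ) = 0 := by
      rw [← hs]; exact Finset.sum_congr rfl fun i _ => mul_comm _ _
    rw [this, sub_zero]
  rw [e]
  have h1 : ∀ i : Fin (d + 1), |(a ^ (i : ℕ) - α ^ (i : ℕ)) * (v i : ℝ)| ≤
      (b - a) * d * R ^ d * H := by
    intro i
    rw [abs_mul]
    have h2 := abs_pow_sub_pow_le a α (i : ℕ)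
    have h3 : |a - α| ≤ b - a := by
      rw [abs_le]; constructor <;> linarith [hα.1, hα.2]
    have h4 : max |a| |α| ≤ R := by
      apply max_le <;> rw [abs_le] <;> constructor <;> linarith [hα.1, hα.2]
    have h5 : max |a| |α| ^ ((i : ℕ) - 1) ≤ R ^ d := by
      calc max |a| |α| ^ ((i : ℕ) - 1) ≤ R ^ ((i : ℕ) - 1) :=
            pow_le_pow_left₀ ((abs_nonneg _).trans (le_max_left _ _)) h4 _
        _ ≤ R ^ d := pow_le_pow_right₀ hR (by omega)
    have h6 : ((i : ℕ) : ℝ) ≤ d := by exact_mod_cast (by omega : (i : ℕ) ≤ d)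
    have h7 : |a ^ (i : ℕ) - α ^ (i : ℕ)| ≤ (b - a) * d * R ^ d := by
      refine h2.trans ?_
      gcongr
    have := hv i
    gcongr
  refine (Finset.abs_sum_le_sum_abs _ _).trans ((Finset.sum_le_sum fun i _ => h1 i).trans ?_)
  rw [Finset.sum_const, Finset.card_univ, Fintype.card_fin, nsmul_eq_mul]
  push_cast
  apply le_of_eq; ring

lemma count_tail (d H : ℕ) (hd : 1 ≤ d) (N : ℝ) (hN : 1 ≤ N) :
    ((algSet d H ∩ {α | N ≤ |α|}).ncard : ℝ) ≤
      d * ((2 * H + 1) ^ d * (2 * (d * H / N) + 1)) := by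
  refine (count_alg d H (Fin.last d) (fun i => if i = Fin.last d then 1 else 0) (by simp) _
    (by positivity) (algSet d H ∩ {α | N ≤ |α|}) inter_subset_left ?_).2
  rintro α ⟨-, hα⟩ v hv hs
  simp only [mem_ofPred_eq] at hα
  have e : ∑ i, (if i = Fin.last d then (1 : ℝ) else 0) * (v i : ℝ) = v (Fin.last d) := by simp
  rw [e, le_div_iff₀ (by linarith)]
  rw [Fin.sum_univ_castSucc] at hs
  simp only [Fin.val_last, Fin.val_castSucc] at hs
  have hα1 : 1 ≤ |α| := hN.trans hα
  have h1 : |(v (Fin.last d) : ℝ)| * |α| ^ d ≤ d * H * |α| ^ (d - 1) := by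
    rw [← abs_pow, ← abs_mul, eq_neg_of_add_eq_zero_right hs, abs_neg]
    refine (Finset.abs_sum_le_sum_abs _ _).trans ?_
    have : ∀ i : Fin d, |(v i.castSucc : ℝ) * α ^ (i : ℕ)| ≤ H * |α| ^ (d - 1) := by
      intro i
      rw [abs_mul, abs_pow]
      have := hv i.castSucc
      have : |α| ^ (i : ℕ) ≤ |α| ^ (d - 1) := pow_le_pow_right₀ hα1 (by omega)
      gcongr
    refine (Finset.sum_le_sum fun i _ => this i).trans ?_
    rw [Finset.sum_const, Finset.card_univ, Fintype.card_fin, nsmul_eq_mul]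
    apply le_of_eq; ring
  obtain ⟨k, rfl⟩ : ∃ k, d = k + 1 := ⟨d - 1, by omega⟩
  rw [pow_succ, Nat.add_sub_cancel] at h1
  have hpos : 0 < |α| ^ k := by positivity
  have h2 : |(v (Fin.last (k + 1)) : ℝ)| * |α| ≤ ((k + 1 : ℕ) : ℝ) * H := by
    by_contra hcon
    push Not at hcon
    have := mul_lt_mul_of_pos_right hcon hpos
    nlinarith
  refine le_trans ?_ h2
  gcongr

lemma irr_root_unique (Q1 Q2 : Polynomial ℤ) (h1 : Irreducible Q1) (h2 : Irreducible Q2)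
    (p1 : Q1.IsPrimitive) (p2 : Q2.IsPrimitive) (l1 : 0 < Q1.leadingCoeff) (l2 : 0 < Q2.leadingCoeff)
    (α : ℝ) (r1 : Polynomial.aeval α Q1 = 0) (r2 : Polynomial.aeval α Q2 = 0) : Q1 = Q2 := by
  have i1 := (Polynomial.IsPrimitive.Int.irreducible_iff_irreducible_map_cast p1).1 h1
  have i2 := (Polynomial.IsPrimitive.Int.irreducible_iff_irreducible_map_cast p2).1 h2
  have e : ∀ Q : Polynomial ℤ, Polynomial.aeval α (Q.map (Int.castRingHom ℚ)) = Polynomial.aeval α Q := by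
    intro Q
    exact Polynomial.aeval_map_algebraMap ℚ α Q
  have r1' : Polynomial.aeval α (Q1.map (Int.castRingHom ℚ)) = 0 := by rw [e, r1]
  have r2' : Polynomial.aeval α (Q2.map (Int.castRingHom ℚ)) = 0 := by rw [e, r2]
  have hIntegral : IsIntegral ℚ α := isAlgebraic_iff_isIntegral.1 ⟨_, i1.ne_zero, r1'⟩
  have hm := minpoly.irreducible hIntegral
  have d1 := minpoly.dvd ℚ α r1'
  have d2 := minpoly.dvd ℚ α r2'
  have d12 : Q1 ∣ Q2 := by
    rw [Polynomial.IsPrimitive.Int.dvd_iff_map_cast_dvd_map_cast _ _ p1]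
    exact (hm.dvd_symm i1 d1).trans d2
  obtain ⟨u, hu⟩ := h1.associated_of_dvd h2 d12
  obtain ⟨r, hr, hru⟩ := Polynomial.isUnit_iff.1 u.isUnit
  rw [← hru] at hu
  rcases Int.isUnit_iff.1 hr with rfl | rfl
  · simpa using hu
  · rw [← hu] at l2
    simp at l2
    omega

def wv (d n : ℕ) (k : Fin (d + 1) → ℕ) (i : Fin (d + 1)) : ℤ :=
  if i = 0 then -(4 * k i + 2) else if i = Fin.last d then 4 * n + 2 * k i + 1 else 2 * k i

def EP (d n : ℕ) (k : Fin (d + 1) → ℕ) : Polynomial ℤ :=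
  ∑ i : Fin (d + 1), Polynomial.monomial (i : ℕ) (wv d n k i)

lemma EP_coeff (d n : ℕ) (k : Fin (d + 1) → ℕ) (i : Fin (d + 1)) :
    (EP d n k).coeff i = wv d n k i := by
  simp only [EP, Polynomial.finsetSum_coeff, Polynomial.coeff_monomial]
  rw [Finset.sum_eq_single i]
  · simp
  · intro b _ hb
    rw [if_neg]
    intro h; exact hb (Fin.ext h)
  · simp

lemma EP_natDegree_le (d n : ℕ) (k : Fin (d + 1) → ℕ) : (EP d n k).natDegree ≤ d := by
  apply Polynomial.natDegree_sum_le_of_forall_le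
  intro i _
  exact (Polynomial.natDegree_monomial_le _).trans (by omega)

lemma last_ne (d : ℕ) (hd : 2 ≤ d) : Fin.last d ≠ 0 := by
  intro h
  have := congrArg Fin.val h
  simp at this
  omega

lemma wv_last (d n : ℕ) (hd : 2 ≤ d) (k : Fin (d + 1) → ℕ) :
    wv d n k (Fin.last d) = 4 * n + 2 * k (Fin.last d) + 1 := by
  rw [wv, if_neg (last_ne d hd), if_pos rfl]

lemma EP_coeff_d (d n : ℕ) (hd : 2 ≤ d) (k : Fin (d + 1) → ℕ) :
    (EP d n k).coeff d = 4 * n + 2 * k (Fin.last d) + 1 := by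
  have := EP_coeff d n k (Fin.last d)
  rw [wv_last d n hd] at this
  exact this

lemma EP_natDegree (d n : ℕ) (hd : 2 ≤ d) (k : Fin (d + 1) → ℕ) : (EP d n k).natDegree = d := by
  apply le_antisymm (EP_natDegree_le d n k)
  apply Polynomial.le_natDegree_of_ne_zero
  rw [EP_coeff_d d n hd]
  omega

lemma wv_abs (d n : ℕ) (k : Fin (d + 1) → ℕ) (hk : ∀ i, k i < n) (i : Fin (d + 1)) :
    (wv d n k i).natAbs ≤ 6 * n := by
  have := hk i
  unfold wv
  split_ifs <;> omega

lemma wv_inj (d n : ℕ) (k k' : Fin (d + 1) → ℕ)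
    (h : ∀ i, (wv d n k i).natAbs = (wv d n k' i).natAbs) : k = k' := by
  funext i
  have := h i
  unfold wv at this
  split_ifs at this <;> omega

/-- the basic facts about the primitive part of the test polynomials -/
lemma EP_prim (d n : ℕ) (hd : 2 ≤ d) (k : Fin (d + 1) → ℕ) (hk : ∀ i, k i < n) :
    0 < (EP d n k).content ∧ Irreducible (EP d n k).primPart ∧
      (EP d n k).primPart.natDegree = d ∧ 0 < (EP d n k).primPart.leadingCoeff ∧
      (∀ i, ((EP d n k).primPart.coeff i).natAbs ≤ 6 * n) ∧
      ∃ α ∈ Icc (0 : ℝ) 1, Polynomial.aeval α (EP d n k).primPart = 0 := by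
  set P := EP d n k with hP
  have hc0 : 0 ≤ P.content := Int.nonneg_of_normalize_eq_self Polynomial.normalize_content
  have hne : P ≠ 0 := by
    intro h
    have := EP_coeff_d d n hd k
    rw [← hP, h] at this
    simp at this
    omega
  have hcpos : 0 < P.content := lt_of_le_of_ne hc0 (by
    intro h; exact hne (Polynomial.content_eq_zero_iff.1 h.symm))
  have hcoef : ∀ i, P.coeff i = P.content * P.primPart.coeff i := by
    intro i
    conv_lhs => rw [P.eq_C_content_mul_primPart]
    rw [Polynomial.coeff_C_mul]
  generalize hc : P.content = c at *
  have hdeg : P.primPart.natDegree = d := by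
    rw [Polynomial.natDegree_primPart]; exact EP_natDegree d n hd k
  have hprim := P.isPrimitive_primPart
  have hrel : ∀ α : ℝ, Polynomial.aeval α P = c * Polynomial.aeval α P.primPart := by
    intro α
    conv_lhs => rw [P.eq_C_content_mul_primPart, hc]
    simp
  generalize hQ : P.primPart = Q at *
  have hd1 := EP_coeff_d d n hd k
  rw [← hP, hcoef] at hd1
  have hodd : Odd c := by
    have : Odd (c * Q.coeff d) := by rw [hd1]; exact ⟨2 * n + k (Fin.last d), by ring⟩
    exact (Int.odd_mul.1 this).1
  have hQd : Odd (Q.coeff d) := by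
    have : Odd (c * Q.coeff d) := by rw [hd1]; exact ⟨2 * n + k (Fin.last d), by ring⟩
    exact (Int.odd_mul.1 this).2
  have hlead : Q.leadingCoeff = Q.coeff d := by rw [Polynomial.leadingCoeff, hdeg]
  refine ⟨hcpos, ?_, hdeg, ?_, ?_, ?_⟩
  · apply Polynomial.irreducible_of_eisenstein_criterion (P := Ideal.span {(2 : ℤ)})
    · rw [Ideal.span_singleton_prime (by norm_num)]; exact Int.prime_two
    · rw [hlead, Ideal.mem_span_singleton]
      rwa [← even_iff_two_dvd, Int.not_even_iff_odd]
    · intro i hi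
      have hi' : i < d := by
        rw [← hdeg]; exact Polynomial.coe_lt_degree.1 hi
      rw [Ideal.mem_span_singleton, ← even_iff_two_dvd]
      have h1 : Even (c * Q.coeff i) := by
        rw [← hcoef]
        have := EP_coeff d n k ⟨i, by omega⟩
        rw [hP]
        simp only at this
        rw [this, wv]
        have hl : (⟨i, by omega⟩ : Fin (d + 1)) ≠ Fin.last d := by
          intro h
          have := congrArg Fin.val h
          simp at this
          omega
        split_ifs with h
        · exact ⟨-(2 * k ⟨i, by omega⟩ + 1), by ring⟩
        · exact ⟨k ⟨i, by omega⟩, by ring⟩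
      rcases Int.even_mul.1 h1 with h | h
      · exact absurd h (Int.not_even_iff_odd.2 hodd)
      · exact h
    · rw [← Polynomial.natDegree_pos_iff_degree_pos, hdeg]; omega
    · rw [Ideal.span_singleton_pow, Ideal.mem_span_singleton]
      intro h
      have h0 := EP_coeff d n k 0
      rw [wv, if_pos rfl] at h0
      have h0' : P.coeff 0 = -(4 * k 0 + 2) := h0
      rw [hcoef] at h0'
      have : (2 : ℤ) ^ 2 ∣ c * Q.coeff 0 := Dvd.dvd.mul_left h c
      rw [h0'] at this
      omega
    · exact hprim
  · rw [hlead]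
    by_contra hcon
    push Not at hcon
    have : c * Q.coeff d ≤ 0 := mul_nonpos_of_nonneg_of_nonpos hcpos.le hcon
    omega
  · intro i
    by_cases hi : i < d + 1
    · have h1 : (P.coeff i).natAbs ≤ 6 * n := by
        have := EP_coeff d n k ⟨i, hi⟩
        simp only at this
        rw [hP, this]
        exact wv_abs d n k hk _
      rw [hcoef, Int.natAbs_mul] at h1
      have h2 : 1 ≤ c.natAbs := by omega
      exact (Nat.le_mul_of_pos_left _ h2).trans h1
    · rw [Polynomial.coeff_eq_zero_of_natDegree_lt (by omega)]
      simp
  · have hev : ∀ α : ℝ, Polynomial.aeval α P = ∑ i : Fin (d + 1), (wv d n k i : ℝ) * α ^ (i : ℕ) := by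
      intro α
      simp [hP, EP, Polynomial.aeval_monomial]
    have hcont : ContinuousOn (fun α : ℝ => Polynomial.aeval α P) (Icc 0 1) :=
      (Polynomial.continuous_aeval P).continuousOn
    have hz : (0 : ℝ) ∈ Icc (Polynomial.aeval (0 : ℝ) P) (Polynomial.aeval (1 : ℝ) P) := by
      constructor
      · rw [hev, Fin.sum_univ_succ]
        simp [wv]
        have hk0 : (0:ℝ) ≤ k 0 := Nat.cast_nonneg _
        linarith
      · rw [hev]
        simp only [one_pow, mul_one]
        have h1 : (0 : ℤ) ≤ ∑ i : Fin (d + 1), wv d n k i := by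
          rw [← Finset.add_sum_erase _ _ (Finset.mem_univ (0 : Fin (d + 1))),
            ← Finset.add_sum_erase _ _ (Finset.mem_erase.2 ⟨last_ne d hd, Finset.mem_univ (Fin.last d)⟩),
            wv_last d n hd]
          have h2 : 0 ≤ ∑ i ∈ (Finset.univ.erase (0 : Fin (d + 1))).erase (Fin.last d), wv d n k i := by
            apply Finset.sum_nonneg
            intro i hi
            simp only [Finset.mem_erase] at hi
            rw [wv, if_neg hi.2.1, if_neg hi.1]
            positivity
          have h3 : wv d n k 0 = -(4 * k 0 + 2) := by rw [wv, if_pos rfl]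
          have := hk 0
          omega
        exact_mod_cast h1
    obtain ⟨α, hα, hroot⟩ := intermediate_value_Icc zero_le_one hcont hz
    refine ⟨α, hα, ?_⟩
    simp only at hroot
    rw [hrel] at hroot
    rcases mul_eq_zero.1 hroot with h | h
    · exfalso
      have : c = 0 := by exact_mod_cast h
      omega
    · exact h

lemma count_lower (d : ℕ) (hd : 2 ≤ d) : ∃ c : ℝ, 0 < c ∧ ∀ H : ℕ, 16 ≤ H →
    c * (H : ℝ) ^ (d + 1) ≤ ((algSet d H ∩ Icc 0 1).ncard : ℝ) := by
  classical
  set M : ℕ := 2 * 12 ^ (d + 1) with hM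
  have hM0 : 0 < M := by positivity
  have hMR : (0 : ℝ) < M := by exact_mod_cast hM0
  refine ⟨1 / (16 ^ (d + 1) * (2 * M)), by positivity, ?_⟩
  intro H hH
  set A := algSet d H ∩ Icc (0 : ℝ) 1 with hA
  have hAfin : A.Finite := (algSet_finite d H).inter_of_left _
  set n := H / 8 with hn
  have hn1 : 1 ≤ n := by omega
  have hnR : (0 : ℝ) < n := by exact_mod_cast hn1
  set S : Finset (Fin (d + 1) → ℕ) := Fintype.piFinset (fun _ => Finset.range n) with hS
  have hmem : ∀ k ∈ S, ∀ i, k i < n := by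
    intro k hk i
    rw [hS, Fintype.mem_piFinset] at hk
    exact Finset.mem_range.1 (hk i)
  have hScard : S.card = n ^ (d + 1) := by
    rw [hS, Fintype.card_piFinset]; simp
  let m : (Fin (d + 1) → ℕ) → ℕ := fun k => (EP d n k).content.natAbs
  have hmdvd : ∀ k i, m k ∣ (wv d n k i).natAbs := by
    intro k i
    rw [← EP_coeff]
    exact Int.natAbs_dvd_natAbs.2 (Polynomial.content_dvd_coeff _)
  have hmaps : Set.MapsTo m (S : Set (Fin (d + 1) → ℕ)) (Finset.Icc 1 (6 * n) : Finset ℕ) := by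
    intro k hk
    have hk' := hmem k hk
    simp only [Finset.coe_Icc, Set.mem_Icc]
    constructor
    · have := (EP_prim d n hd k hk').1
      simp only [m]; omega
    · refine (Nat.le_of_dvd ?_ (hmdvd k (Fin.last d))).trans (wv_abs d n k hk' _)
      rw [wv_last d n hd]; omega
  have hfib1 : ∀ b, ({k ∈ S | m k = b}).card ≤ A.ncard := by
    intro b
    rw [Set.ncard_eq_toFinset_card A hAfin]
    have hex : ∀ k : Fin (d + 1) → ℕ, ∃ α : ℝ, k ∈ S → α ∈ Icc (0 : ℝ) 1 ∧
        Polynomial.aeval α (EP d n k).primPart = 0 := by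
      intro k
      by_cases hk : k ∈ S
      · obtain ⟨α, h1, h2⟩ := (EP_prim d n hd k (hmem k hk)).2.2.2.2.2
        exact ⟨α, fun _ => ⟨h1, h2⟩⟩
      · exact ⟨0, fun h => absurd h hk⟩
    choose F hF using hex
    apply Finset.card_le_card_of_injOn F
    · intro k hk
      simp only [Finset.coe_filter, mem_ofPred_eq] at hk
      simp only [Set.Finite.coe_toFinset]
      obtain ⟨h1, h2, h3, h4, h5, -⟩ := EP_prim d n hd k (hmem k hk.1)
      refine ⟨⟨_, h2, h3, ?_, (hF k hk.1).2⟩, (hF k hk.1).1⟩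
      intro i
      have h6 := h5 i
      rw [← Int.cast_abs, Int.abs_eq_natAbs]
      have : ((EP d n k).primPart.coeff i).natAbs ≤ H := by omega
      exact_mod_cast this
    · intro k hk k' hk' heq
      simp only [Finset.coe_filter, mem_ofPred_eq] at hk hk'
      obtain ⟨h1, h2, h3, h4, h5, -⟩ := EP_prim d n hd k (hmem k hk.1)
      obtain ⟨h1', h2', h3', h4', h5', -⟩ := EP_prim d n hd k' (hmem k' hk'.1)
      have hQ := irr_root_unique _ _ h2 h2' (Polynomial.isPrimitive_primPart _)
        (Polynomial.isPrimitive_primPart _) h4 h4' (F k) (hF k hk.1).2 (by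
          rw [heq]; exact (hF k' hk'.1).2)
      have hc : (EP d n k).content = (EP d n k').content := by
        have := hk.2.trans hk'.2.symm
        simp only [m] at this
        omega
      have hE : EP d n k = EP d n k' := by
        rw [(EP d n k).eq_C_content_mul_primPart, (EP d n k').eq_C_content_mul_primPart, hc, hQ]
      apply wv_inj d n
      intro i
      rw [← EP_coeff, ← EP_coeff, hE]
  have hfib2 : ∀ b ∈ Finset.Ioc M (6 * n), (({k ∈ S | m k = b}).card : ℝ) ≤
      (12 * n) ^ (d + 1) * ((b : ℝ) ^ 2)⁻¹ := by
    intro b hb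
    rw [Finset.mem_Ioc] at hb
    have hb0 : 0 < b := by omega
    have hbR : (1 : ℝ) ≤ b := by exact_mod_cast hb0
    have h1 : ({k ∈ S | m k = b}).card ≤
        (Fintype.piFinset (fun _ : Fin (d + 1) => Finset.range (6 * n / b + 1))).card := by
      apply Finset.card_le_card_of_injOn (fun k i => (wv d n k i).natAbs / b)
      · intro k hk
        simp only [Finset.coe_filter, mem_ofPred_eq] at hk
        rw [Finset.mem_coe, Fintype.mem_piFinset]
        intro i
        rw [Finset.mem_range, Nat.lt_succ_iff]
        exact Nat.div_le_div_right (wv_abs d n k (hmem k hk.1) i)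
      · intro k hk k' hk' heq
        simp only [Finset.coe_filter, mem_ofPred_eq] at hk hk'
        apply wv_inj d n
        intro i
        have := congrFun heq i
        simp only at this
        have d1 := hmdvd k i
        have d2 := hmdvd k' i
        rw [hk.2] at d1
        rw [hk'.2] at d2
        rw [← Nat.div_mul_cancel d1, ← Nat.div_mul_cancel d2, this]
    rw [Fintype.card_piFinset] at h1
    simp only [Finset.card_range, Finset.prod_const, Finset.card_univ, Fintype.card_fin] at h1
    have h2 : ((6 * n / b + 1 : ℕ) : ℝ) ≤ 12 * n / b := by
      have h3 : ((6 * n / b : ℕ) : ℝ) ≤ ((6 * n : ℕ) : ℝ) / b := Nat.cast_div_le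
      have h4 : (1 : ℝ) ≤ ((6 * n : ℕ) : ℝ) / b := by
        rw [one_le_div (by linarith)]; exact_mod_cast hb.2
      push_cast at h3 h4 ⊢
      calc _ ≤ 6 * (n : ℝ) / b + 6 * n / b := by linarith
        _ = _ := by ring
    calc (({k ∈ S | m k = b}).card : ℝ) ≤ ((6 * n / b + 1 : ℕ) : ℝ) ^ (d + 1) := by exact_mod_cast h1
      _ ≤ (12 * n / b) ^ (d + 1) := by gcongr
      _ = (12 * n) ^ (d + 1) * ((b : ℝ) ^ (d + 1))⁻¹ := by rw [div_pow]; rfl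
      _ ≤ _ := by
        gcongr
        omega
  have htot : S.card = ∑ b ∈ Finset.Icc 1 (6 * n), ({k ∈ S | m k = b}).card :=
    Finset.card_eq_sum_card_fiberwise hmaps
  have hsub : Finset.Icc 1 (6 * n) ⊆ Finset.Icc 1 M ∪ Finset.Ioc M (6 * n) := by
    intro x hx
    simp only [Finset.mem_union, Finset.mem_Icc, Finset.mem_Ioc] at hx ⊢
    omega
  have hdisj : Disjoint (Finset.Icc 1 M) (Finset.Ioc M (6 * n)) := by
    rw [Finset.disjoint_left]
    intro x hx hx'
    simp only [Finset.mem_Icc, Finset.mem_Ioc] at hx hx'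
    omega
  have hb1 : (S.card : ℝ) ≤ ∑ b ∈ Finset.Icc 1 M, (({k ∈ S | m k = b}).card : ℝ) +
      ∑ b ∈ Finset.Ioc M (6 * n), (({k ∈ S | m k = b}).card : ℝ) := by
    rw [← Finset.sum_union hdisj, htot]
    push_cast
    exact Finset.sum_le_sum_of_subset_of_nonneg hsub fun _ _ _ => by positivity
  have hb2 : ∑ b ∈ Finset.Icc 1 M, (({k ∈ S | m k = b}).card : ℝ) ≤ M * (A.ncard : ℝ) := by
    refine (Finset.sum_le_card_nsmul _ _ (A.ncard : ℝ) fun b _ => by exact_mod_cast hfib1 b).trans ?_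
    rw [Nat.card_Icc, nsmul_eq_mul, Nat.add_sub_cancel]
  have hb3 : ∑ b ∈ Finset.Ioc M (6 * n), (({k ∈ S | m k = b}).card : ℝ) ≤ (n : ℝ) ^ (d + 1) / 2 := by
    refine (Finset.sum_le_sum hfib2).trans ?_
    rw [← Finset.mul_sum]
    have h1 : ∑ b ∈ Finset.Ioc M (6 * n), ((b : ℝ) ^ 2)⁻¹ ≤ (M : ℝ)⁻¹ := by
      rcases le_total M (6 * n) with h | h
      · have := sum_Ioc_inv_sq_le_sub (α := ℝ) hM0.ne' h
        have h2 : (0 : ℝ) ≤ ((6 * n : ℕ) : ℝ)⁻¹ := by positivity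
        linarith
      · rw [Finset.Ioc_eq_empty_of_le h]; simp
    calc _ ≤ (12 * (n : ℝ)) ^ (d + 1) * (M : ℝ)⁻¹ := by gcongr
      _ = _ := by
        rw [hM]; push_cast; rw [mul_pow]; field_simp
  have hb4 : (n : ℝ) ^ (d + 1) / 2 ≤ M * (A.ncard : ℝ) := by
    rw [hScard] at hb1
    push_cast at hb1
    linarith
  have hHn : (H : ℝ) ≤ 16 * n := by exact_mod_cast (by omega : H ≤ 16 * n)
  have hb5 : (H : ℝ) ^ (d + 1) ≤ 16 ^ (d + 1) * (n : ℝ) ^ (d + 1) := by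
    rw [← mul_pow]; gcongr
  rw [div_mul_eq_mul_div, one_mul, div_le_iff₀ (by positivity)]
  have : (16 : ℝ) ^ (d + 1) * (n : ℝ) ^ (d + 1) ≤ 16 ^ (d + 1) * (2 * (M * (A.ncard : ℝ))) := by
    gcongr; linarith
  linarith

lemma grid_lemma (K : Set ℝ) (hK : IsCompact K) (hK1 : K ⊆ Icc 0 1) (ε : ℝ) (hε : 0 < ε)
    (hv : volume K < ENNReal.ofReal ε) :
    ∃ N : ℕ, 0 < N ∧ ∃ T : Finset ℕ, (T.card : ℝ) ≤ ε * N ∧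
      (∀ j ∈ T, j < N) ∧
      ∀ x ∈ K, ∃ j ∈ T, (j : ℝ) / N ≤ x ∧ x ≤ ((j : ℝ) + 1) / N := by
  classical
  obtain ⟨U, hKU, hUo, hU⟩ := Set.exists_isOpen_lt_of_lt K _ hv
  obtain ⟨δ, hδ, hth⟩ := hK.exists_thickening_subset_open hUo hKU
  obtain ⟨N, hN⟩ := exists_nat_gt (1 / δ)
  have hNpos : (0 : ℝ) < N := lt_trans (by positivity) hN
  have hN0 : 0 < N := by exact_mod_cast hNpos
  have hNδ : 1 / (N : ℝ) < δ := by
    rw [div_lt_iff₀ hNpos]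
    rw [div_lt_iff₀ hδ] at hN
    linarith
  set T : Finset ℕ := {j ∈ Finset.range N | ∃ x ∈ K, (j : ℝ) / N ≤ x ∧ x ≤ ((j : ℝ) + 1) / N} with hT
  refine ⟨N, hN0, T, ?_, ?_, ?_⟩
  · have hsub : (⋃ j ∈ T, Ico ((j : ℝ) / N) (((j : ℝ) + 1) / N)) ⊆ U := by
      intro y hy
      simp only [mem_iUnion] at hy
      obtain ⟨j, hj, hy1, hy2⟩ := hy
      rw [hT, Finset.mem_filter] at hj
      obtain ⟨_, x, hx, hx1, hx2⟩ := hj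
      apply hth
      rw [Metric.mem_thickening_iff]
      refine ⟨x, hx, ?_⟩
      rw [Real.dist_eq, abs_lt]
      have : ((j : ℝ) + 1) / N = j / N + 1 / N := by ring
      constructor <;> linarith
    have hdisj : (T : Set ℕ).PairwiseDisjoint (fun j : ℕ => Ico ((j : ℝ) / N) (((j : ℝ) + 1) / N)) := by
      intro i _ j _ hij
      rw [Function.onFun, Set.disjoint_left]
      rintro y ⟨h1, h2⟩ ⟨h3, h4⟩
      rw [div_le_iff₀ hNpos] at h1 h3
      rw [lt_div_iff₀ hNpos] at h2 h4
      have h5 : (i : ℝ) < j + 1 := by linarith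
      have h6 : (j : ℝ) < i + 1 := by linarith
      have h7 : i < j + 1 := by exact_mod_cast h5
      have h8 : j < i + 1 := by exact_mod_cast h6
      omega
    have hm := measure_biUnion_finset (μ := (volume : Measure ℝ)) hdisj (fun j _ => measurableSet_Ico)
    have hle : (T.card : ENNReal) * ENNReal.ofReal (1 / N) ≤ ENNReal.ofReal ε := by
      have h1 := (measure_mono (μ := (volume : Measure ℝ)) hsub).trans hU.le
      rw [hm] at h1
      refine le_trans (le_of_eq ?_) h1
      rw [← nsmul_eq_mul, ← Finset.sum_const]
      refine Finset.sum_congr rfl fun j _ => ?_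
      rw [Real.volume_Ico]
      congr 1
      ring
    rw [← ENNReal.ofReal_natCast, ← ENNReal.ofReal_mul (by positivity),
      ENNReal.ofReal_le_ofReal_iff hε.le, mul_one_div, div_le_iff₀ hNpos] at hle
    exact hle
  · intro j hj
    rw [hT, Finset.mem_filter, Finset.mem_range] at hj
    exact hj.1
  · intro x hx
    have hx01 := hK1 hx
    by_cases h1 : x = 1
    · have hc : (((N - 1 : ℕ) : ℝ)) = N - 1 := by
        rw [Nat.cast_sub hN0]; simp
      have key : ((N - 1 : ℕ) : ℝ) / N ≤ x ∧ x ≤ (((N - 1 : ℕ) : ℝ) + 1) / N := by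
        rw [hc, h1]
        constructor
        · rw [div_le_one hNpos]; linarith
        · rw [sub_add_cancel, div_self hNpos.ne']
      refine ⟨N - 1, ?_, key⟩
      rw [hT, Finset.mem_filter, Finset.mem_range]
      exact ⟨by omega, x, hx, key⟩
    · have hlt : x < 1 := lt_of_le_of_ne hx01.2 h1
      have hxN : 0 ≤ x * N := mul_nonneg hx01.1 hNpos.le
      have key : ((⌊x * N⌋₊ : ℕ) : ℝ) / N ≤ x ∧ x ≤ (((⌊x * N⌋₊ : ℕ) : ℝ) + 1) / N := by
        constructor
        · rw [div_le_iff₀ hNpos]; exact Nat.floor_le hxN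
        · rw [le_div_iff₀ hNpos]; exact (Nat.lt_floor_add_one _).le
      refine ⟨⌊x * N⌋₊, ?_, key⟩
      rw [hT, Finset.mem_filter, Finset.mem_range]
      refine ⟨?_, x, hx, key⟩
      rw [Nat.floor_lt hxN]
      nlinarith

lemma XSet_sub (d : ℕ) (H : ℝ) (prime : Bool) : XSet d H prime ⊆ algSet d H := by
  unfold XSet
  split_ifs
  · exact inter_subset_left
  · exact subset_rfl

lemma sub_XSet (d : ℕ) (H : ℝ) (prime : Bool) : algSet d H ∩ Icc 0 1 ⊆ XSet d H prime := by
  unfold XSet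
  split_ifs
  · exact subset_rfl
  · exact inter_subset_left

lemma XSet_finite (d H : ℕ) (prime : Bool) : (XSet d H prime).Finite :=
  (algSet_finite d H).subset (XSet_sub _ _ _)

lemma count_cover (d H : ℕ) (hd : 2 ≤ d) (prime : Bool) (K : Set ℝ) (N N0 : ℕ) (hN : 0 < N)
    (hN0 : 0 < N0) (T : Finset ℕ) (hTN : ∀ j ∈ T, j < N)
    (hcov : ∀ x ∈ K, ∃ j ∈ T, (j : ℝ) / N ≤ x ∧ x ≤ ((j : ℝ) + 1) / N) :
    (countModOne (XSet d H prime) K : ℝ) ≤ d * ((2*H+1)^d * (2*(d*H/N0) + 1)) +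
      (2 * N0 * T.card) * (d * ((2*H+1)^d * (2*((1/N)*H*((d+1)*d*(N0:ℝ)^d)) + 1))) := by
  classical
  have hNr : (0 : ℝ) < N := by exact_mod_cast hN
  have hN0r : (1 : ℝ) ≤ N0 := by exact_mod_cast hN0
  have hfin := algSet_finite d H
  set I : Finset (ℤ × ℕ) := (Finset.Ico (-(N0:ℤ)) N0) ×ˢ T with hI
  set S : ℤ × ℕ → Set ℝ := fun i =>
    algSet d H ∩ Icc ((i.1 : ℝ) + (i.2 : ℝ) / N) ((i.1 : ℝ) + ((i.2 : ℝ) + 1) / N) with hS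
  have hsub : {α : ℝ | α ∈ XSet d H prime ∧ Int.fract α ∈ K} ⊆
      (algSet d H ∩ {α | (N0 : ℝ) ≤ |α|}) ∪ ⋃ i ∈ I, S i := by
    rintro α ⟨hα, hfr⟩
    have hα' := XSet_sub _ _ _ hα
    by_cases h : (N0 : ℝ) ≤ |α|
    · exact Or.inl ⟨hα', h⟩
    · right
      push Not at h
      rw [abs_lt] at h
      obtain ⟨j, hj, hj1, hj2⟩ := hcov _ hfr
      simp only [mem_iUnion]
      have hfl := Int.floor_add_fract α
      refine ⟨(⌊α⌋, j), ?_, hα', ?_, ?_⟩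
      · rw [hI, Finset.mem_product, Finset.mem_Ico]
        refine ⟨⟨?_, ?_⟩, hj⟩
        · rw [Int.le_floor]; push_cast; exact h.1.le
        · rw [Int.floor_lt]; push_cast; exact h.2
      · show (⌊α⌋ : ℝ) + (j : ℝ) / N ≤ α
        linarith
      · show α ≤ (⌊α⌋ : ℝ) + ((j : ℝ) + 1) / N
        linarith
  have hUfin : (⋃ i ∈ I, S i).Finite :=
    hfin.subset (by
      intro x hx
      simp only [mem_iUnion] at hx
      obtain ⟨i, _, hx⟩ := hx
      exact hx.1)
  have h1 : countModOne (XSet d H prime) K ≤ (algSet d H ∩ {α | (N0 : ℝ) ≤ |α|}).ncard +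
      ∑ i ∈ I, (S i).ncard := by
    unfold countModOne
    refine (Set.ncard_le_ncard hsub ((hfin.subset inter_subset_left).union hUfin)).trans ?_
    refine (Set.ncard_union_le _ _).trans ?_
    gcongr
    exact Finset.set_ncard_biUnion_le I S
  have h2 : ∀ i ∈ I, ((S i).ncard : ℝ) ≤
      d * ((2*H+1)^d * (2*((1/N)*H*((d+1)*d*(N0:ℝ)^d)) + 1)) := by
    rintro ⟨n, j⟩ hi
    rw [hI, Finset.mem_product, Finset.mem_Ico] at hi
    obtain ⟨⟨hn1, hn2⟩, hj⟩ := hi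
    simp only at hn1 hn2 hj
    have hjN := hTN j hj
    have e1 : -(N0 : ℝ) ≤ n := by exact_mod_cast hn1
    have e2 : (n : ℝ) + 1 ≤ N0 := by exact_mod_cast hn2
    have e3 : (j : ℝ) + 1 ≤ N := by exact_mod_cast hjN
    have e4 : (0 : ℝ) ≤ (j : ℝ) / N := by positivity
    have e5 : ((j : ℝ) + 1) / N ≤ 1 := by rw [div_le_one hNr]; exact e3
    have e6 : ((j : ℝ) + 1) / N = j / N + 1 / N := by ring
    have e7 : (0 : ℝ) < 1 / N := by positivity
    have := count_interval d H ((n : ℝ) + (j : ℝ) / N) ((n : ℝ) + ((j : ℝ) + 1) / N) N0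
      (by linarith) hN0r (by linarith) (by linarith)
    have e8 : ((n : ℝ) + ((j : ℝ) + 1) / N) - ((n : ℝ) + (j : ℝ) / N) = 1 / N := by rw [e6]; ring
    rw [e8] at this
    exact this
  have hcard : (I.card : ℝ) = 2 * N0 * T.card := by
    have : I.card = 2 * N0 * T.card := by
      rw [hI, Finset.card_product, Int.card_Ico]
      congr 1
      omega
    rw [this]; push_cast; ring
  calc (countModOne (XSet d H prime) K : ℝ) ≤ ((algSet d H ∩ {α | (N0 : ℝ) ≤ |α|}).ncard : ℝ) +
      ∑ i ∈ I, ((S i).ncard : ℝ) := by exact_mod_cast h1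
    _ ≤ d * ((2*H+1)^d * (2*(d*H/N0) + 1)) +
      ∑ i ∈ I, (d * ((2*H+1)^d * (2*((1/N)*H*((d+1)*d*(N0:ℝ)^d)) + 1)) : ℝ) := by
        gcongr with i hi
        · exact count_tail d H (by omega) N0 hN0r
        · exact h2 i hi
    _ = _ := by
        rw [Finset.sum_const, nsmul_eq_mul, hcard]

lemma count_small (d : ℕ) (hd : 2 ≤ d) (prime : Bool) (ε : ℝ) (hε : 0 < ε) :
    ∃ δ : ℝ, 0 < δ ∧ ∀ K : Set ℝ, IsCompact K → K ⊆ Icc 0 1 → volume K < ENNReal.ofReal δ →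
      ∀ᶠ H : ℕ in Filter.atTop, (countModOne (XSet d H prime) K : ℝ) ≤
        ε * (Set.ncard (XSet d H prime) : ℝ) ∧ 0 < Set.ncard (XSet d H prime) := by
  obtain ⟨c, hc, hlow⟩ := count_lower d hd
  have hdr : (0 : ℝ) < d := by exact_mod_cast (by omega : 0 < d)
  -- main constants
  set A : ℝ := d * 3 ^ d with hA
  have hApos : 0 < A := by positivity
  set η : ℝ := ε * c / 3 with hη
  have hηpos : 0 < η := by positivity
  obtain ⟨N0, hN0⟩ := exists_nat_gt (max 1 (A * (2 * d) / η))
  have hN0a : (1 : ℝ) < N0 := lt_of_le_of_lt (le_max_left _ _) hN0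
  have hN0b : A * (2 * d) / η < N0 := lt_of_le_of_lt (le_max_right _ _) hN0
  have hN0n : 0 < N0 := by
    have : (0 : ℝ) < N0 := by linarith
    exact_mod_cast this
  have hN0p : (0 : ℝ) < N0 := by linarith
  set B : ℝ := A * (2 * N0) * (2 * ((d + 1) * d * (N0 : ℝ) ^ d)) with hB
  have hBpos : 0 < B := by positivity
  refine ⟨η / B, by positivity, fun K hK hK1 hv => ?_⟩
  obtain ⟨N, hN, T, hTc, hTN, hcov⟩ := grid_lemma K hK hK1 (η / B) (by positivity) hv
  have hNr : (0 : ℝ) < N := by exact_mod_cast hN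
  set D : ℝ := A * (1 + 2 * N0 * T.card) with hD
  obtain ⟨H0, hH0⟩ := exists_nat_gt (D / η)
  filter_upwards [Filter.eventually_ge_atTop (max 16 H0)] with H hH
  have hH16 : 16 ≤ H := le_trans (le_max_left _ _) hH
  have hHH0 : H0 ≤ H := le_trans (le_max_right _ _) hH
  have hHp : (1 : ℝ) ≤ H := by exact_mod_cast (by omega : 1 ≤ H)
  have hX : c * (H:ℝ)^(d+1) ≤ (Set.ncard (XSet d H prime) : ℝ) := by
    refine (hlow H hH16).trans ?_
    exact_mod_cast Set.ncard_le_ncard (sub_XSet d H prime) (XSet_finite d H prime)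
  have hXpos : (0 : ℝ) < (Set.ncard (XSet d H prime) : ℝ) := lt_of_lt_of_le (by positivity) hX
  refine ⟨?_, by exact_mod_cast hXpos⟩
  have hcc := count_cover d H hd prime K N N0 hN hN0n T hTN hcov
  have hpow : (2 * (H : ℝ) + 1) ^ d ≤ 3 ^ d * (H : ℝ) ^ d := by
    rw [← mul_pow]
    gcongr
    linarith
  have hP : (0 : ℝ) < (H : ℝ) ^ d := by positivity
  have hDH : D ≤ η * H := by
    rw [div_lt_iff₀ hηpos] at hH0
    have : (H0 : ℝ) ≤ H := by exact_mod_cast hHH0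
    nlinarith
  have hfirst : A * (2 * (d * H / N0)) ≤ η * H := by
    rw [div_lt_iff₀ hηpos] at hN0b
    have : A * (2 * (d * H / N0)) = (A * (2 * d)) * H / N0 := by ring
    rw [this, div_le_iff₀ hN0p]
    nlinarith
  have hsecond : A * ((2 * N0 * T.card) * (2*((1/N)*H*((d+1)*d*(N0:ℝ)^d)))) ≤ η * H := by
    have e : A * ((2 * N0 * T.card) * (2*((1/N)*H*((d+1)*d*(N0:ℝ)^d)))) = B * H * (T.card / N) := by
      rw [hB]; ring
    have e2 : (T.card : ℝ) / N ≤ η / B := by rw [div_le_iff₀ hNr]; exact hTc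
    rw [e]
    calc B * H * (T.card / N) ≤ B * H * (η / B) := by gcongr
      _ = η * H := by field_simp
  calc (countModOne (XSet d H prime) K : ℝ) ≤ _ := hcc
    _ ≤ d * ((3 ^ d * (H : ℝ) ^ d) * (2*(d*H/N0) + 1)) +
      (2 * N0 * T.card) * (d * ((3 ^ d * (H : ℝ) ^ d) * (2*((1/N)*H*((d+1)*d*(N0:ℝ)^d)) + 1))) := by
        gcongr
    _ = (A * (2 * (d * H / N0)) + A * ((2 * N0 * T.card) * (2*((1/N)*H*((d+1)*d*(N0:ℝ)^d)))) + D)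
        * (H : ℝ) ^ d := by rw [hD, hA]; ring
    _ ≤ (η * H + η * H + η * H) * (H : ℝ) ^ d := by gcongr
    _ = ε * (c * (H:ℝ)^(d+1)) := by rw [hη]; ring
    _ ≤ _ := by gcongr

lemma lim_helper (u : ℕ → ℝ) (h01 : ∀ n, u n ∈ Icc (0 : ℝ) 1) (a b : ℝ)
    (h : ∀ᶠ n in Filter.atTop, u n ∈ Icc a b) :
    Filter.limsup u Filter.atTop ∈ Icc a b ∧ Filter.liminf u Filter.atTop ∈ Icc a b := by
  have hbu : Filter.IsBoundedUnder (· ≤ ·) Filter.atTop u :=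
    Filter.isBoundedUnder_of ⟨1, fun n => (h01 n).2⟩
  have hbl : Filter.IsBoundedUnder (· ≥ ·) Filter.atTop u :=
    Filter.isBoundedUnder_of ⟨0, fun n => (h01 n).1⟩
  have h1 : Filter.limsup u Filter.atTop ≤ b :=
    Filter.limsup_le_of_le hbl.isCoboundedUnder_le (h.mono fun n hn => hn.2)
  have h2 : a ≤ Filter.liminf u Filter.atTop :=
    Filter.le_liminf_of_le hbu.isCoboundedUnder_ge (h.mono fun n hn => hn.1)
  have h3 : Filter.liminf u Filter.atTop ≤ Filter.limsup u Filter.atTop :=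
    Filter.liminf_le_limsup hbu hbl
  exact ⟨⟨h2.trans h3, h1⟩, ⟨h2, h3.trans h1⟩⟩

lemma ratio_mem (d : ℕ) (prime : Bool) (Ψ : ℝ → ℝ) (Q₁ Q₂ H : ℕ) :
    ratioRoth d prime Ψ Q₁ Q₂ H ∈ Icc (0 : ℝ) 1 := by
  unfold ratioRoth countModOne
  refine ⟨by positivity, ?_⟩
  refine div_le_one_of_le₀ ?_ (by positivity)
  have hsub : {α : ℝ | α ∈ XSet d H prime ∧ Int.fract α ∈ JPsi Ψ Q₁ Q₂} ⊆ XSet d H prime :=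
    fun x hx => hx.1
  exact_mod_cast Set.ncard_le_ncard hsub (XSet_finite d H prime)

lemma density_mem (d : ℕ) (prime : Bool) (Ψ : ℝ → ℝ) (a b : ℝ)
    (h : ∀ᶠ Q₁ : ℕ in Filter.atTop, ∀ᶠ Q₂ : ℕ in Filter.atTop, ∀ᶠ H : ℕ in Filter.atTop,
      ratioRoth d prime Ψ Q₁ Q₂ H ∈ Icc a b) :
    upperDensity d prime Ψ ∈ Icc a b ∧ lowerDensity d prime Ψ ∈ Icc a b := by
  have b1 : ∀ Q₁ Q₂ : ℕ, _ := fun Q₁ Q₂ =>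
    lim_helper (fun H : ℕ => ratioRoth d prime Ψ Q₁ Q₂ H) (ratio_mem d prime Ψ Q₁ Q₂) 0 1
      (Filter.Eventually.of_forall (ratio_mem d prime Ψ Q₁ Q₂))
  have b2 : ∀ Q₁ : ℕ, _ := fun Q₁ =>
    lim_helper (fun Q₂ : ℕ => Filter.limsup (fun H : ℕ => ratioRoth d prime Ψ Q₁ Q₂ H) Filter.atTop)
      (fun Q₂ => (b1 Q₁ Q₂).1) 0 1 (Filter.Eventually.of_forall (fun Q₂ => (b1 Q₁ Q₂).1))
  have b3 : ∀ Q₁ : ℕ, _ := fun Q₁ =>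
    lim_helper (fun Q₂ : ℕ => Filter.liminf (fun H : ℕ => ratioRoth d prime Ψ Q₁ Q₂ H) Filter.atTop)
      (fun Q₂ => (b1 Q₁ Q₂).2) 0 1 (Filter.Eventually.of_forall (fun Q₂ => (b1 Q₁ Q₂).2))
  constructor
  · refine (lim_helper _ (fun Q₁ => (b2 Q₁).1) a b ?_).1
    filter_upwards [h] with Q₁ h1
    refine (lim_helper _ (fun Q₂ => (b1 Q₁ Q₂).1) a b ?_).1
    filter_upwards [h1] with Q₂ h2
    exact (lim_helper _ (ratio_mem d prime Ψ Q₁ Q₂) a b h2).1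
  · refine (lim_helper _ (fun Q₁ => (b3 Q₁).2) a b ?_).2
    filter_upwards [h] with Q₁ h1
    refine (lim_helper _ (fun Q₂ => (b1 Q₁ Q₂).2) a b ?_).2
    filter_upwards [h1] with Q₂ h2
    exact (lim_helper _ (ratio_mem d prime Ψ Q₁ Q₂) a b h2).2

lemma JPsi_sub (Ψ : ℝ → ℝ) (Q₁ Q₂ : ℕ) : JPsi Ψ Q₁ Q₂ ⊆ Icc 0 1 := by
  intro x hx
  simp only [JPsi, mem_iUnion] at hx
  obtain ⟨_, _, _, _, hx⟩ := hx
  exact hx.2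

lemma isCompact_JPsi (Ψ : ℝ → ℝ) (Q₁ Q₂ : ℕ) : IsCompact (JPsi Ψ Q₁ Q₂) := by
  unfold JPsi
  refine Finset.isCompact_biUnion _ fun q _ => Finset.isCompact_biUnion _ fun p _ => ?_
  exact isCompact_Icc.inter isCompact_Icc

lemma volume_JPsi (Ψ : ℝ → ℝ) (hΨ : IsApproxFun Ψ) (Q₁ Q₂ : ℕ) (hQ : 1 ≤ Q₁) :
    volume (JPsi Ψ Q₁ Q₂) ≤ ENNReal.ofReal (∑ q ∈ Finset.Ico Q₁ Q₂, 4 * Ψ q) := by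
  have hq : ∀ q ∈ Finset.Ico Q₁ Q₂, (1 : ℝ) ≤ q := by
    intro q hq
    have := (Finset.mem_Ico.1 hq).1
    exact_mod_cast hQ.trans this
  rw [ENNReal.ofReal_sum_of_nonneg (fun q hq' => by
    have := hΨ.1 q (by linarith [hq q hq']); linarith)]
  unfold JPsi
  refine (measure_biUnion_finset_le _ _).trans (Finset.sum_le_sum fun q hq' => ?_)
  have h1 := hq q hq'
  have hP := hΨ.1 q (by linarith)
  refine (measure_biUnion_finset_le _ _).trans ?_
  have h2 : ∀ p ∈ Finset.range (q + 1), volume (Set.Icc ((p : ℝ) / q - Ψ q / q) ((p : ℝ) / q + Ψ q / q) ∩ Set.Icc 0 1)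
      ≤ ENNReal.ofReal (2 * (Ψ q / q)) := by
    intro p _
    refine (measure_mono inter_subset_left).trans ?_
    rw [Real.volume_Icc]
    apply ENNReal.ofReal_le_ofReal
    linarith
  refine (Finset.sum_le_sum h2).trans ?_
  rw [Finset.sum_const, Finset.card_range, nsmul_eq_mul, ← ENNReal.ofReal_natCast,
    ← ENNReal.ofReal_mul (by positivity)]
  apply ENNReal.ofReal_le_ofReal
  push_cast
  have h3 : ((q : ℝ) + 1) * (2 * (Ψ q / q)) = 2 * Ψ q * ((q + 1) / q) := by ring
  have h4 : ((q : ℝ) + 1) / q ≤ 2 := by rw [div_le_iff₀ (by linarith)]; linarith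
  rw [h3]
  nlinarith

lemma conv_volume (Ψ : ℝ → ℝ) (hΨ : IsApproxFun Ψ) (hs : Summable (fun q : ℕ => Ψ ((q : ℝ) + 1)))
    (δ : ℝ) (hδ : 0 < δ) :
    ∀ᶠ Q₁ : ℕ in Filter.atTop, ∀ Q₂ : ℕ, volume (JPsi Ψ Q₁ Q₂) < ENNReal.ofReal δ := by
  have hs' : Summable (fun q : ℕ => 4 * Ψ (q : ℝ)) := by
    rw [← summable_nat_add_iff 1]
    simpa using hs.mul_left 4
  have ht := tendsto_sum_nat_add (fun q : ℕ => 4 * Ψ (q : ℝ))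
  filter_upwards [ht.eventually (gt_mem_nhds hδ), Filter.eventually_ge_atTop 1] with Q₁ h1 h2 Q₂
  refine (volume_JPsi Ψ hΨ Q₁ Q₂ h2).trans_lt ?_
  rw [ENNReal.ofReal_lt_ofReal_iff hδ]
  refine lt_of_le_of_lt ?_ h1
  rw [Finset.sum_Ico_eq_sum_range]
  have hsum : Summable (fun q : ℕ => 4 * Ψ ((q + Q₁ : ℕ) : ℝ)) :=
    (summable_nat_add_iff (f := fun q : ℕ => 4 * Ψ (q : ℝ)) Q₁).2 hs'
  have := hsum.sum_le_tsum (Finset.range (Q₂ - Q₁)) (fun q _ => by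
    have := hΨ.1 ((q + Q₁ : ℕ) : ℝ) (by exact_mod_cast (by omega : 0 < q + Q₁))
    linarith)
  refine le_trans (le_of_eq ?_) this
  refine Finset.sum_congr rfl fun q _ => ?_
  rw [add_comm]

lemma Icc_sub_cover (Ψ : ℝ → ℝ) (Q₁ Q₂ : ℕ) (x : ℝ) (hx : x ∈ Icc (0 : ℝ) 1) :
    x ∈ JPsi Ψ Q₁ Q₂ ∨ x ∈ KPsi Ψ Q₁ Q₂ := by
  by_cases h : x ∈ GPsi Ψ Q₁ Q₂
  · left
    simp only [GPsi, JPsi, mem_iUnion] at h ⊢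
    obtain ⟨q, hq, p, hp, h⟩ := h
    exact ⟨q, hq, p, hp, Ioo_subset_Icc_self h, hx⟩
  · right
    exact ⟨hx, h⟩

lemma count_compl (d H : ℕ) (prime : Bool) (Ψ : ℝ → ℝ) (Q₁ Q₂ : ℕ) :
    (XSet d H prime).ncard ≤ countModOne (XSet d H prime) (JPsi Ψ Q₁ Q₂) +
      countModOne (XSet d H prime) (KPsi Ψ Q₁ Q₂) := by
  unfold countModOne
  have hf := XSet_finite d H prime
  refine le_trans (Set.ncard_le_ncard ?_ ((hf.subset fun x hx => hx.1).union
    (hf.subset fun x hx => hx.1))) (Set.ncard_union_le _ _)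
  intro α hα
  rcases Icc_sub_cover Ψ Q₁ Q₂ (Int.fract α) ⟨Int.fract_nonneg _, (Int.fract_lt_one _).le⟩ with h | h
  · exact Or.inl ⟨hα, h⟩
  · exact Or.inr ⟨hα, h⟩

theorem stmt2 (d : ℕ) (hd : 2 ≤ d) (prime : Bool) (Ψ : ℝ → ℝ) (hΨ : IsApproxFun Ψ) :
    (Summable (fun q : ℕ => Ψ ((q : ℝ) + 1)) →
      upperDensity d prime Ψ = 0 ∧ lowerDensity d prime Ψ = 0) ∧
    (¬ Summable (fun q : ℕ => Ψ ((q : ℝ) + 1)) →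
      upperDensity d prime Ψ = 1 ∧ lowerDensity d prime Ψ = 1) := by
  constructor
  · intro hs
    have key : ∀ ε : ℝ, 0 < ε → upperDensity d prime Ψ ∈ Icc 0 ε ∧ lowerDensity d prime Ψ ∈ Icc 0 ε := by
      intro ε hε
      apply density_mem
      obtain ⟨δ, hδ, hK⟩ := count_small d hd prime ε hε
      filter_upwards [conv_volume Ψ hΨ hs δ hδ] with Q₁ h1
      refine Filter.Eventually.of_forall fun Q₂ => ?_
      filter_upwards [hK _ (isCompact_JPsi Ψ Q₁ Q₂) (JPsi_sub Ψ Q₁ Q₂) (h1 Q₂)] with H hH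
      refine ⟨(ratio_mem d prime Ψ Q₁ Q₂ H).1, ?_⟩
      unfold ratioRoth
      rw [div_le_iff₀ (by exact_mod_cast hH.2)]
      exact hH.1
    constructor
    · exact le_antisymm (le_of_forall_pos_le_add fun ε hε => by
        simpa using (key ε hε).1.2) (key 1 one_pos).1.1
    · exact le_antisymm (le_of_forall_pos_le_add fun ε hε => by
        simpa using (key ε hε).2.2) (key 1 one_pos).2.1
  · intro hns
    have key : ∀ ε : ℝ, 0 < ε → upperDensity d prime Ψ ∈ Icc (1 - ε) 1 ∧
        lowerDensity d prime Ψ ∈ Icc (1 - ε) 1 := by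
      intro ε hε
      apply density_mem
      obtain ⟨δ, hδ, hK⟩ := count_small d hd prime ε hε
      filter_upwards [khin_real Ψ hΨ hns] with Q₁ h1
      filter_upwards [h1.eventually (gt_mem_nhds (ENNReal.ofReal_pos.2 hδ))] with Q₂ h2
      filter_upwards [hK _ (isCompact_KPsi Ψ Q₁ Q₂) (fun x hx => hx.1) h2] with H hH
      refine ⟨?_, (ratio_mem d prime Ψ Q₁ Q₂ H).2⟩
      unfold ratioRoth
      rw [le_div_iff₀ (by exact_mod_cast hH.2)]
      have h3 : ((XSet d H prime).ncard : ℝ) ≤ countModOne (XSet d H prime) (JPsi Ψ Q₁ Q₂) +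
        countModOne (XSet d H prime) (KPsi Ψ Q₁ Q₂) := by
        exact_mod_cast count_compl d H prime Ψ Q₁ Q₂
      linarith [hH.1]
    constructor
    · refine le_antisymm (key 1 one_pos).1.2 (le_of_forall_pos_le_add fun ε hε => ?_)
      linarith [(key ε hε).1.1]
    · refine le_antisymm (key 1 one_pos).2.2 (le_of_forall_pos_le_add fun ε hε => ?_)
      linarith [(key ε hε).2.1]
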